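/- Let k be a field of characteristic not 2 or 3 and let m ∈ {1,2,4,8}. Two (8,m)-product algebras (A,−) and (A′,−) over k are isotopic if and only if their Albert forms are similar (i.e. one Albert form is isometric to a nonzero scalar multiple of the other). -/

import Mathlib

open scoped TensorProduct

noncomputable section

universe u

/-- A unital, not necessarily associative, algebra with involution over a commutative ring. -/
structure AlgebraWithInvolution (R : Type u) [CommRing R] : Type (u + 1) where
  carrier : Type u
  [isNonAssocRing : NonAssocRing carrier]
  [isModule : Module R carrier]
  [isSMulCommClass : SMulCommClass R carrier carrier]
  [isScalarTower : IsScalarTower R carrier carrier]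
  invol : carrier →ₗ[R] carrier
  invol_one : invol 1 = 1
  invol_mul : ∀ x y : carrier, invol (x * y) = invol y * invol x
  invol_invol : ∀ x : carrier, invol (invol x) = x

namespace AlgebraWithInvolution

attribute [instance] isNonAssocRing isModule isSMulCommClass isScalarTower

instance {R : Type u} [CommRing R] : CoeSort (AlgebraWithInvolution R) (Type u) :=
  ⟨carrier⟩

variable {R : Type u} [CommRing R]

/-- The operator `V_{x,y} z = (x ȳ) z + (z ȳ) x − (z x̄) y` of a (candidate) structurable
algebra. -/
def Vop (A : AlgebraWithInvolution R) (x y z : A) : A :=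
  (x * A.invol y) * z + (z * A.invol y) * x - (z * A.invol x) * y

/-- `(A,−)` is a structurable algebra:
`[V_{x,y}, V_{z,w}] = V_{V_{x,y} z, w} − V_{z, V_{y,x} w}`. -/
def IsStructurable (A : AlgebraWithInvolution R) : Prop :=
  ∀ x y z w v : A,
    A.Vop x y (A.Vop z w v) - A.Vop z w (A.Vop x y v) =
      A.Vop (A.Vop x y z) w v - A.Vop z (A.Vop y x w) v

/-- An element `x` is conjugate-invertible if `V_{x,y} = id` for some `y`. -/
def ConjInvertible (A : AlgebraWithInvolution R) (x : A) : Prop :=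
  ∃ y : A, ∀ z : A, A.Vop x y z = z

/-- A structurable division algebra: every nonzero element is conjugate-invertible. -/
def IsStructurableDivisionAlgebra (A : AlgebraWithInvolution R) : Prop :=
  ∀ x : A, x ≠ 0 → A.ConjInvertible x

/-- The submodule of skew elements of an algebra with involution. -/
def skew (A : AlgebraWithInvolution R) : Submodule R A.carrier where
  carrier := {a | A.invol a = -a}
  add_mem' := by
    intro a b ha hb
    simp only [Set.mem_setOf_eq, map_add] at *
    rw [ha, hb, neg_add]
  zero_mem' := by simp
  smul_mem' := by
    intro c a ha
    simp only [Set.mem_setOf_eq, map_smul] at *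
    rw [ha, smul_neg]

/-- `ψ(x,y) = x ȳ − y x̄`. -/
def psi (A : AlgebraWithInvolution R) (x y : A) : A :=
  x * A.invol y - y * A.invol x

/-- Isomorphisms of algebras with involution. -/
structure Iso (A B : AlgebraWithInvolution R) where
  toLinearEquiv : A.carrier ≃ₗ[R] B.carrier
  map_mul : ∀ x y : A, toLinearEquiv (x * y) = toLinearEquiv x * toLinearEquiv y
  map_one : toLinearEquiv 1 = 1
  map_invol : ∀ x : A, toLinearEquiv (A.invol x) = B.invol (toLinearEquiv x)

/-- Isotopies of (structurable) algebras with involution: pairs `(α, α̂)` of linear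
bijections with `α ∘ V_{x,y} ∘ α⁻¹ = V_{α x, α̂ y}`. -/
structure Isotopy (A B : AlgebraWithInvolution R) where
  toLinearEquiv : A.carrier ≃ₗ[R] B.carrier
  hat : A.carrier ≃ₗ[R] B.carrier
  map_Vop : ∀ x y z : A,
    toLinearEquiv (A.Vop x y z) = B.Vop (toLinearEquiv x) (hat y) (toLinearEquiv z)

/-- Two algebras with involution are isotopic if there is an isotopy between them. -/
def IsIsotopic (A B : AlgebraWithInvolution R) : Prop :=
  Nonempty (A.Isotopy B)

/-- The tensor product of two algebras with involution. -/
def tensor (A B : AlgebraWithInvolution R) : AlgebraWithInvolution R where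
  carrier := A.carrier ⊗[R] B.carrier
  invol := TensorProduct.map A.invol B.invol
  invol_one := by
    simp [Algebra.TensorProduct.one_def, A.invol_one, B.invol_one]
  invol_mul := by
    intro x y
    induction x with
    | zero => simp
    | tmul a b =>
      induction y with
      | zero => simp
      | tmul c d =>
        simp [Algebra.TensorProduct.tmul_mul_tmul, A.invol_mul, B.invol_mul]
      | add u v hu hv =>
        simp only [mul_add, map_add, hu, hv, add_mul]
    | add u v hu hv =>
      simp only [add_mul, map_add, hu, hv, mul_add]
  invol_invol := by
    intro x
    induction x with
    | zero => simp
    | tmul a b => simp [A.invol_invol, B.invol_invol]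
    | add u v hu hv => simp [hu, hv]

/-- Base change of an algebra with involution along `R → S`. -/
def baseChange (A : AlgebraWithInvolution R) (S : Type u) [CommRing S] [Algebra R S] :
    AlgebraWithInvolution S where
  carrier := S ⊗[R] A.carrier
  invol := LinearMap.baseChange S A.invol
  invol_one := by
    simp [Algebra.TensorProduct.one_def, A.invol_one]
  invol_mul := by
    intro x y
    induction x with
    | zero => simp
    | tmul s a =>
      induction y with
      | zero => simp
      | tmul t b =>
        simp only [Algebra.TensorProduct.tmul_mul_tmul, LinearMap.baseChange_tmul,
          A.invol_mul, mul_comm s t]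
      | add u v hu hv =>
        simp only [mul_add, map_add, hu, hv, add_mul]
    | add u v hu hv =>
      simp only [add_mul, map_add, hu, hv, mul_add]
  invol_invol := by
    intro x
    induction x with
    | zero => simp
    | tmul s a => simp [A.invol_invol]
    | add u v hu hv => simp [hu, hv]

end AlgebraWithInvolution

/-- A composition algebra over a field `F`: a unital (possibly non-associative) algebra with a
nondegenerate multiplicative quadratic form, together with its standard involution
`x̄ = b(x,1)·1 − x` (where `b` is the polar form of the norm). -/
structure CompositionAlgebra (F : Type u) [Field F] : Type (u + 1) where
  carrier : Type u
  [isNonAssocRing : NonAssocRing carrier]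
  [isModule : Module F carrier]
  [isSMulCommClass : SMulCommClass F carrier carrier]
  [isScalarTower : IsScalarTower F carrier carrier]
  [isFinite : FiniteDimensional F carrier]
  norm : QuadraticForm F carrier
  norm_one : norm 1 = 1
  norm_mul : ∀ x y : carrier, norm (x * y) = norm x * norm y
  nondegenerate : ∀ x : carrier, (∀ y : carrier, norm (x + y) - norm x - norm y = 0) → x = 0
  conj : carrier →ₗ[F] carrier
  conj_def : ∀ x : carrier, conj x = (norm (x + 1) - norm x - norm 1) • (1 : carrier) - x
  conj_one : conj 1 = 1
  conj_mul : ∀ x y : carrier, conj (x * y) = conj y * conj x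
  conj_conj : ∀ x : carrier, conj (conj x) = x

namespace CompositionAlgebra

attribute [instance] isNonAssocRing isModule isSMulCommClass isScalarTower isFinite

variable {F : Type u} [Field F]

/-- A composition algebra, viewed as an algebra with its standard involution. -/
def toAWI (C : CompositionAlgebra F) : AlgebraWithInvolution F where
  carrier := C.carrier
  invol := C.conj
  invol_one := C.conj_one
  invol_mul := C.conj_mul
  invol_invol := C.conj_conj

end CompositionAlgebra

/-- A splitting datum witnessing that `(A,−)` is an `(m₁, m₂)`-product algebra: a field
extension `K/k` over which `(A,−)` becomes isomorphic, as an algebra with involution, to the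
tensor product of two composition algebras (with their standard involutions) of dimensions
`m₁` and `m₂`. -/
structure ProductAlgebraSplitting {k : Type u} [Field k]
    (A : AlgebraWithInvolution k) (m₁ m₂ : ℕ) : Type (u + 1) where
  K : Type u
  [fieldK : Field K]
  [algK : Algebra k K]
  C₁ : CompositionAlgebra K
  C₂ : CompositionAlgebra K
  finrank₁ : Module.finrank K C₁.carrier = m₁
  finrank₂ : Module.finrank K C₂.carrier = m₂
  iso : (A.baseChange K).Iso (C₁.toAWI.tensor C₂.toAWI)

attribute [instance] ProductAlgebraSplitting.fieldK ProductAlgebraSplitting.algK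

/-- `(A,−)` is an `(m₁, m₂)`-product algebra. -/
def IsProductAlgebra {k : Type u} [Field k] (A : AlgebraWithInvolution k) (m₁ m₂ : ℕ) : Prop :=
  Nonempty (ProductAlgebraSplitting A m₁ m₂)

/-- An Albert form of an `(m₁,m₂)`-product algebra `(A,−)`: a quadratic form `Q` on the space
of skew elements, together with the `♮`-map, satisfying `L_s ∘ L_{s♮} = −Q(s)·id` and such that
`Q(s) ≠ 0` iff left multiplication by `s` is invertible. -/
structure AlbertForm {k : Type u} [Field k] (A : AlgebraWithInvolution k) where
  Q : QuadraticForm k A.skew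
  natMap : A.skew →ₗ[k] A.skew
  mul_natMap : ∀ (s : A.skew) (a : A.carrier),
    (s : A.carrier) * ((natMap s : A.carrier) * a) = -(Q s) • a
  nonzero_iff : ∀ s : A.skew,
    Q s ≠ 0 ↔ Function.Bijective fun a : A.carrier => (s : A.carrier) * a

end

section LinearAlgebra

universe u

/-- Two linear maps which are proportional on every anisotropic vector of a nonzero quadratic
form are proportional, provided that one of them is injective. -/
lemma exists_smul_eq_of_anisotropic {F : Type*} [Field F] (h2 : (2 : F) ≠ 0) (h3 : (3 : F) ≠ 0)
    {V X : Type*} [AddCommGroup V] [Module F V] [AddCommGroup X] [Module F X]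
    (Q : QuadraticForm F V) (v₀ : V) (hv₀ : Q v₀ ≠ 0) (f g : V →ₗ[F] X)
    (hf : Function.Injective f) (hfg : ∀ v, Q v ≠ 0 → ∃ μ : F, g v = μ • f v) :
    ∃ μ : F, ∀ v, g v = μ • f v := by
  obtain ⟨μ₀, hμ₀⟩ := hfg v₀ hv₀
  refine ⟨μ₀, fun w => ?_⟩
  by_cases hw : ∃ a : F, w = a • v₀
  · obtain ⟨a, rfl⟩ := hw
    rw [map_smul, map_smul, hμ₀, smul_comm]
  have hind : ∀ a b : F, a • w + b • v₀ = 0 → a = 0 ∧ b = 0 := by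
    intro a b hab
    have ha : a = 0 := by
      by_contra ha
      refine hw ⟨-(a⁻¹ * b), ?_⟩
      have h := congrArg (fun z => a⁻¹ • z) hab
      simp only [smul_add, smul_smul, inv_mul_cancel₀ ha, one_smul, smul_zero] at h
      rw [neg_smul]
      exact eq_neg_of_add_eq_zero_left h
    subst ha
    have hv : v₀ ≠ 0 := by
      rintro rfl
      exact hv₀ (map_zero Q)
    simpa [hv] using hab
  have hQ : ∀ c : F, Q (w + c • v₀) =
      Q w + c * QuadraticMap.polar Q w v₀ + c * c * Q v₀ := by
    intro c
    have h : Q (w + c • v₀) = Q w + Q (c • v₀) + QuadraticMap.polar Q w (c • v₀) := by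
      rw [QuadraticMap.polar]; ring
    rw [h, QuadraticMap.map_smul, QuadraticMap.polar_smul_right, smul_eq_mul, smul_eq_mul]
    ring
  -- two admissible values of the parameter suffice
  have key : ∀ c d : F, c ≠ d → Q (w + c • v₀) ≠ 0 → Q (w + d • v₀) ≠ 0 → g w = μ₀ • f w := by
    intro c d hcd hc hd
    obtain ⟨μ, hμ⟩ := hfg _ hc
    obtain ⟨ν, hν⟩ := hfg _ hd
    simp only [map_add, map_smul, hμ₀] at hμ hν
    have h : f ((μ - ν) • w + (c * (μ - μ₀) - d * (ν - μ₀)) • v₀) = 0 := by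
      simp only [map_add, map_smul]
      linear_combination (norm := module) hν - hμ
    obtain ⟨h1, h4⟩ := hind _ _ ((map_eq_zero_iff f hf).1 h)
    have h5 : μ = ν := sub_eq_zero.1 h1
    subst h5
    have h6 : (c - d) * (μ - μ₀) = 0 := by linear_combination h4
    have h7 : μ = μ₀ := by
      rcases mul_eq_zero.1 h6 with h | h
      · exact absurd (sub_eq_zero.1 h) hcd
      · exact sub_eq_zero.1 h
    subst h7
    linear_combination (norm := module) hμ
  -- a nonzero quadratic polynomial has at most two roots
  have root : ∀ a b c : F, a ≠ b → a ≠ c → b ≠ c → Q (w + a • v₀) = 0 →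
      Q (w + b • v₀) = 0 → Q (w + c • v₀) ≠ 0 := by
    intro a b c hab hac hbc ha hb hc
    rw [hQ] at ha hb hc
    have h1 : (a - b) * (QuadraticMap.polar Q w v₀ + (a + b) * Q v₀) = 0 := by
      linear_combination ha - hb
    have h2 : (a - c) * (QuadraticMap.polar Q w v₀ + (a + c) * Q v₀) = 0 := by
      linear_combination ha - hc
    have h1' := (mul_eq_zero.1 h1).resolve_left (sub_ne_zero.2 hab)
    have h2' := (mul_eq_zero.1 h2).resolve_left (sub_ne_zero.2 hac)
    have h4 : (b - c) * Q v₀ = 0 := by linear_combination h1' - h2'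
    exact hv₀ ((mul_eq_zero.1 h4).resolve_left (sub_ne_zero.2 hbc))
  have n01 : (0 : F) ≠ 1 := zero_ne_one
  have n02 : (0 : F) ≠ 2 := h2.symm
  have n12 : (1 : F) ≠ 2 := fun h => one_ne_zero (by linear_combination -h : (1 : F) = 0)
  have n0m : (0 : F) ≠ -1 := fun h => one_ne_zero (by linear_combination h : (1 : F) = 0)
  have n1m : (1 : F) ≠ -1 := fun h => h2 (by linear_combination h)
  have n2m : (2 : F) ≠ -1 := fun h => h3 (by linear_combination h)
  by_cases q0 : Q (w + (0 : F) • v₀) = 0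
  · by_cases q1 : Q (w + (1 : F) • v₀) = 0
    · exact key 2 (-1) n2m (root 0 1 2 n01 n02 n12 q0 q1) (root 0 1 (-1) n01 n0m n1m q0 q1)
    · by_cases q2 : Q (w + (2 : F) • v₀) = 0
      · exact key 1 (-1) n1m q1 (root 0 2 (-1) n02 n0m n2m q0 q2)
      · exact key 1 2 n12 q1 q2
  · by_cases q1 : Q (w + (1 : F) • v₀) = 0
    · by_cases q2 : Q (w + (2 : F) • v₀) = 0
      · exact key 0 (-1) n0m q0 (root 1 2 (-1) n12 n1m n2m q1 q2)
      · exact key 0 2 n02 q0 q2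
    · exact key 0 1 n01 q0 q1

/-- Commuting isometric involutions of a symmetric bilinear space that is not totally isotropic
have a common anisotropic eigenvector. -/
lemma exists_common_eigenvector {F : Type*} [Field F] (h2 : (2 : F) ≠ 0)
    {V : Type*} [AddCommGroup V] [Module F V] (b : LinearMap.BilinForm F V)
    {ι : Type*} [Finite ι] (c : ι → V →ₗ[F] V)
    (hc : ∀ i v, c i (c i v) = v) (hcomm : ∀ i j, i ≠ j → ∀ v, c i (c j v) = c j (c i v))
    (hiso : ∀ i v w, b (c i v) (c i w) = b v w) (v₀ : V) (hv₀ : b v₀ v₀ ≠ 0) :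
    ∃ (ε : ι → F) (v : V), (∀ i, ε i * ε i = 1) ∧ b v v ≠ 0 ∧ ∀ i, c i v = ε i • v := by
  classical
  have := Fintype.ofFinite ι
  suffices H : ∀ s : Finset ι, ∃ (ε : ι → F) (v : V), (∀ i, ε i * ε i = 1) ∧ b v v ≠ 0 ∧
      ∀ i ∈ s, c i v = ε i • v by
    obtain ⟨ε, v, h1, h2, h3⟩ := H Finset.univ
    exact ⟨ε, v, h1, h2, fun i => h3 i (Finset.mem_univ i)⟩
  intro s
  induction s using Finset.induction_on with
  | empty => exact ⟨fun _ => 1, v₀, by simp, hv₀, by simp⟩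
  | insert i s his ih =>
    obtain ⟨ε, v, h1, hv, h3⟩ := ih
    have split : 2 * (2 * b v v) = b (v + c i v) (v + c i v) + b (v - c i v) (v - c i v) := by
      simp only [map_add, map_sub, LinearMap.add_apply, LinearMap.sub_apply, hiso]
      ring
    have main : ∀ η : F, η * η = 1 → b (v + η • c i v) (v + η • c i v) ≠ 0 →
        ∃ (ε : ι → F) (v : V), (∀ i, ε i * ε i = 1) ∧ b v v ≠ 0 ∧
          ∀ j ∈ insert i s, c j v = ε j • v := by
      intro η hη hne
      refine ⟨Function.update ε i η, v + η • c i v, ?_, hne, ?_⟩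
      · intro j
        by_cases hj : j = i
        · subst hj; simpa using hη
        · simpa [hj] using h1 j
      · intro j hj
        rcases Finset.mem_insert.1 hj with rfl | hj
        · simp only [Function.update_self, map_add, map_smul, hc, smul_add, smul_smul, hη,
            one_smul]
          exact add_comm _ _
        · have hji : j ≠ i := fun h => his (h ▸ hj)
          rw [Function.update_of_ne hji, map_add, map_smul, hcomm j i hji, h3 j hj, map_smul,
            smul_add, smul_comm η]
    by_cases hp : b (v + c i v) (v + c i v) = 0
    · refine main (-1) (by ring) ?_
      rw [neg_one_smul, ← sub_eq_add_neg]
      intro hm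
      rw [hp, hm, add_zero] at split
      exact hv ((mul_eq_zero.1 ((mul_eq_zero.1 split).resolve_left h2)).resolve_left h2)
    · refine main 1 (by ring) ?_
      rwa [one_smul]

/-- A nondegenerate quadratic form over a field of characteristic not two has an orthogonal
basis of anisotropic vectors. -/
lemma exists_anisotropic_orthogonal_basis {F : Type*} [Field F] (h2 : (2 : F) ≠ 0)
    {V : Type*} [AddCommGroup V] [Module F V] [FiniteDimensional F V] (Q : QuadraticForm F V)
    (hQ : ∀ x, (∀ y, QuadraticMap.polar Q x y = 0) → x = 0) :
    ∃ e : Module.Basis (Fin (Module.finrank F V)) F V,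
      (∀ i j, i ≠ j → QuadraticMap.polar Q (e i) (e j) = 0) ∧ ∀ i, Q (e i) ≠ 0 := by
  have : Invertible (2 : F) := invertibleOfNonzero h2
  have hsymm : (Q.polarBilin).IsSymm :=
    ⟨fun x y => by simpa using QuadraticMap.polar_comm Q x y⟩
  obtain ⟨e, he⟩ := LinearMap.BilinForm.exists_orthogonal_basis hsymm
  have he' : ∀ i j, i ≠ j → QuadraticMap.polar Q (e i) (e j) = 0 := fun i j hij => he hij
  refine ⟨e, he', fun i hi => e.ne_zero i (hQ _ fun y => ?_)⟩
  have : Q.polarBilin (e i) = 0 := by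
    refine e.ext fun j => ?_
    by_cases hij : i = j
    · subst hij
      simp [QuadraticMap.polar_self, hi]
    · simpa using he' i j hij
  exact DFunLike.congr_fun this y

/-- The expansion of a vector in an orthogonal basis. -/
lemma sum_polar_smul_eq {F : Type*} [Field F] (h2 : (2 : F) ≠ 0)
    {V ι : Type*} [AddCommGroup V] [Module F V] [Fintype ι] (Q : QuadraticForm F V)
    (e : Module.Basis ι F V) (he : ∀ i j, i ≠ j → QuadraticMap.polar Q (e i) (e j) = 0)
    (hQ : ∀ i, Q (e i) ≠ 0) (i : ι) (x : V) :
    e.repr x i = (2 * Q (e i))⁻¹ * QuadraticMap.polar Q (e i) x := by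
  have h : QuadraticMap.polar Q (e i) x = 2 * Q (e i) * e.repr x i := by
    conv_lhs => rw [← e.sum_repr x]
    change Q.polarBilin (e i) (∑ j, e.repr x j • e j) = _
    rw [map_sum, Finset.sum_eq_single i]
    · simp [QuadraticMap.polar_self]; ring
    · intro j _ hj
      simp [he i j hj.symm]
    · simp
  rw [h, inv_mul_cancel_left₀ (mul_ne_zero h2 (hQ i))]

end LinearAlgebra

section Composition

universe u

namespace CompositionAlgebra

variable {F : Type u} [Field F] (C : CompositionAlgebra F)

/-- The polar form of the norm. -/
def bil : LinearMap.BilinForm F C.carrier := C.norm.polarBilin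

lemma bil_apply (x y : C.carrier) : C.bil x y = C.norm (x + y) - C.norm x - C.norm y := rfl

lemma norm_add (x y : C.carrier) : C.norm (x + y) = C.norm x + C.norm y + C.bil x y := by
  rw [bil_apply]; ring

lemma bil_comm (x y : C.carrier) : C.bil x y = C.bil y x :=
  QuadraticMap.polar_comm C.norm x y

lemma bil_self (x : C.carrier) : C.bil x x = 2 * C.norm x := by
  change QuadraticMap.polar C.norm x x = _
  rw [QuadraticMap.polar_self]; simp

lemma bil_one_one : C.bil 1 1 = 2 := by rw [bil_self, C.norm_one, mul_one]

lemma ext_bil {x y : C.carrier} (h : ∀ z, C.bil x z = C.bil y z) : x = y := by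
  refine sub_eq_zero.1 (C.nondegenerate _ fun z => ?_)
  rw [← bil_apply, map_sub, LinearMap.sub_apply, h, sub_self]

lemma bil_mul_left (x y z : C.carrier) : C.bil (x * y) (x * z) = C.norm x * C.bil y z := by
  rw [bil_apply, bil_apply, ← mul_add, C.norm_mul, C.norm_mul, C.norm_mul]; ring

lemma bil_mul_right (x y z : C.carrier) : C.bil (x * z) (y * z) = C.bil x y * C.norm z := by
  rw [bil_apply, bil_apply, ← add_mul, C.norm_mul, C.norm_mul, C.norm_mul]; ring

lemma bil_mul_mul (x y w z : C.carrier) :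
    C.bil (x * y) (w * z) + C.bil (x * z) (w * y) = C.bil x w * C.bil y z := by
  have h := C.bil_mul_left (x + w) y z
  have h1 := C.bil_mul_left x y z
  have h2 := C.bil_mul_left w y z
  simp only [add_mul, map_add, LinearMap.add_apply, norm_add] at h
  rw [C.bil_comm (x * z)]
  linear_combination h - h1 - h2

lemma conj_eq (x : C.carrier) : C.conj x = C.bil x 1 • (1 : C.carrier) - x := by
  rw [C.conj_def, bil_apply]

lemma bil_mul_eq_left (x y z : C.carrier) : C.bil (x * y) z = C.bil y (C.conj x * z) := by
  have h := C.bil_mul_mul x y 1 z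
  rw [one_mul, one_mul, C.bil_comm (x * z)] at h
  rw [conj_eq, sub_mul, smul_mul_assoc, one_mul, map_sub, map_smul, smul_eq_mul]
  linear_combination h

lemma bil_mul_eq_right (x y z : C.carrier) : C.bil (x * y) z = C.bil x (z * C.conj y) := by
  have h := C.bil_mul_mul x y z 1
  rw [mul_one, mul_one] at h
  rw [conj_eq, mul_sub, mul_smul_comm, mul_one, map_sub, map_smul, smul_eq_mul]
  linear_combination h

lemma bil_conj_conj (x y : C.carrier) : C.bil (C.conj x) (C.conj y) = C.bil x y := by
  rw [conj_eq, conj_eq]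
  simp only [map_sub, map_smul, LinearMap.sub_apply, LinearMap.smul_apply, smul_eq_mul,
    bil_one_one, C.bil_comm 1 y]
  ring

lemma bil_conj_one (x : C.carrier) : C.bil (C.conj x) 1 = C.bil x 1 := by
  conv_lhs => rw [← C.conj_one, bil_conj_conj]

lemma bil_conj_left (x y : C.carrier) : C.bil (C.conj x) y = C.bil x (C.conj y) := by
  conv_lhs => rw [← C.conj_conj y, bil_conj_conj]

lemma conj_mul_mul_self (x y : C.carrier) : C.conj x * (x * y) = C.norm x • y := by
  refine C.ext_bil fun z => ?_
  rw [bil_mul_eq_left, C.conj_conj, bil_mul_left, map_smul, LinearMap.smul_apply, smul_eq_mul]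

lemma mul_mul_conj_self (x y : C.carrier) : (x * y) * C.conj y = C.norm y • x := by
  refine C.ext_bil fun z => ?_
  rw [bil_mul_eq_right, C.conj_conj, bil_mul_right, map_smul, LinearMap.smul_apply,
    smul_eq_mul, mul_comm]

lemma conj_mul_mul_add (x y z : C.carrier) :
    C.conj x * (y * z) + C.conj y * (x * z) = C.bil x y • z := by
  have h := C.conj_mul_mul_self (x + y) z
  have h1 := C.conj_mul_mul_self x z
  have h2 := C.conj_mul_mul_self y z
  simp only [map_add, add_mul, mul_add, norm_add] at h
  linear_combination (norm := module) h - h1 - h2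

lemma mul_conj_mul_add (x y z : C.carrier) :
    x * (C.conj y * z) + y * (C.conj x * z) = C.bil x y • z := by
  have h := C.conj_mul_mul_add (C.conj x) (C.conj y) z
  rwa [bil_conj_conj, C.conj_conj, C.conj_conj] at h

lemma mul_mul_conj_add (x y z : C.carrier) :
    (z * x) * C.conj y + (z * y) * C.conj x = C.bil x y • z := by
  have h := C.mul_mul_conj_self z (x + y)
  have h1 := C.mul_mul_conj_self z x
  have h2 := C.mul_mul_conj_self z y
  simp only [map_add, add_mul, mul_add, norm_add] at h
  linear_combination (norm := module) h - h1 - h2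

lemma mul_conj_mul_add' (x y z : C.carrier) :
    (z * C.conj x) * y + (z * C.conj y) * x = C.bil x y • z := by
  have h := C.mul_mul_conj_add (C.conj x) (C.conj y) z
  rwa [bil_conj_conj, C.conj_conj, C.conj_conj] at h

lemma mul_conj_add (x y : C.carrier) :
    x * C.conj y + y * C.conj x = C.bil x y • (1 : C.carrier) := by
  simpa using C.mul_conj_mul_add x y 1

lemma conj_mul_add (x y : C.carrier) :
    C.conj x * y + C.conj y * x = C.bil x y • (1 : C.carrier) := by
  simpa using C.conj_mul_mul_add x y 1

lemma mul_mul_add_mul_mul (a s z : C.carrier) :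
    a * (s * z) + s * (a * z) = (a * s + s * a) * z := by
  have h := C.conj_mul_mul_add a s z
  have h' := C.conj_mul_add a s
  simp only [conj_eq, sub_mul, smul_mul_assoc, one_mul] at h h'
  rw [add_mul]
  have hh := congrArg (· * z) h'
  simp only [add_mul, sub_mul, smul_mul_assoc, one_mul] at hh
  linear_combination (norm := module) hh - h

lemma mul_mul_mul_self (y x : C.carrier) :
    y * (x * y) = C.bil x (C.conj y) • y - C.norm y • C.conj x := by
  have h := C.mul_conj_mul_add y (C.conj x) y
  have h' : C.conj y * y = C.norm y • (1 : C.carrier) := by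
    simpa using C.conj_mul_mul_self y 1
  rw [C.conj_conj, h', mul_smul_comm, mul_one, C.bil_comm y, bil_conj_left] at h
  linear_combination (norm := module) h

/-- The right Moufang identity. -/
lemma moufang (s x y : C.carrier) : ((s * y) * x) * y = s * (y * (x * y)) := by
  refine C.ext_bil fun w => ?_
  have h := C.bil_mul_mul (s * y) (C.conj x) w y
  have h1 : C.bil ((s * y * x) * y) w = C.bil (s * y) ((w * C.conj y) * C.conj x) := by
    rw [bil_mul_eq_right, bil_mul_eq_right]
  have h2 := C.mul_conj_mul_add' x x w
  have h3 : (w * C.conj y) * C.conj x + (w * x) * y = C.bil x (C.conj y) • w := by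
    simpa [C.conj_conj, C.bil_comm] using C.mul_mul_conj_add (C.conj y) x w
  have h4 : (w * C.conj y) * C.conj x = C.bil x (C.conj y) • w - (w * x) * y := by
    rw [← h3, add_sub_cancel_right]
  rw [h1, h4, map_sub, bil_mul_right, mul_mul_mul_self, mul_sub, mul_smul_comm, mul_smul_comm]
  simp only [map_sub, map_smul, LinearMap.sub_apply, LinearMap.smul_apply, smul_eq_mul]
  rw [C.bil_mul_eq_right s (C.conj x) w, C.conj_conj]
  ring

lemma moufang_add (s x y z : C.carrier) :
    ((s * z) * x) * y + ((s * y) * x) * z = s * (z * (x * y)) + s * (y * (x * z)) := by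
  have h := C.moufang s x (y + z)
  have h1 := C.moufang s x y
  have h2 := C.moufang s x z
  simp only [mul_add, add_mul] at h
  linear_combination (norm := module) h - h1 - h2

lemma mul_mul_add_flexible (x y z : C.carrier) :
    z * (x * y) + y * (x * z) = (z * x) * y + (y * x) * z := by
  simpa using (C.moufang_add 1 x y z).symm

lemma moufang_add' (s x y z : C.carrier) :
    ((s * z) * x) * y + ((s * y) * x) * z = s * ((z * x) * y) + s * ((y * x) * z) := by
  rw [moufang_add, ← mul_add, ← mul_add, mul_mul_add_flexible]

end CompositionAlgebra

end Composition

section CompositionSums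

universe u

namespace CompositionAlgebra

variable {F : Type u} [Field F] (C : CompositionAlgebra F)

/-- An orthogonal basis of anisotropic vectors, with the coefficients of the dual basis. -/
lemma exists_orthogonal_expansion (h2 : (2 : F) ≠ 0) :
    ∃ (e : Module.Basis (Fin (Module.finrank F C.carrier)) F C.carrier)
      (r : Fin (Module.finrank F C.carrier) → F),
      (∀ j, r j * C.norm (e j) = 2⁻¹) ∧ (∀ j x, e.repr x j = r j * C.bil (e j) x) := by
  obtain ⟨e, he, hn⟩ := exists_anisotropic_orthogonal_basis h2 C.norm C.nondegenerate
  refine ⟨e, fun j => (2 * C.norm (e j))⁻¹, fun j => ?_, fun j x =>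
    sum_polar_smul_eq h2 C.norm e he hn j x⟩
  have := hn j
  field_simp

/-- The trace of a left multiplication. -/
lemma trace_mulLeft (h2 : (2 : F) ≠ 0) (a : C.carrier) :
    LinearMap.trace F C.carrier (LinearMap.mulLeft F a) =
      Module.finrank F C.carrier * 2⁻¹ * C.bil a 1 := by
  obtain ⟨e, r, hr, he⟩ := C.exists_orthogonal_expansion h2
  rw [LinearMap.trace_eq_matrix_trace F e, Matrix.trace]
  have : ∀ j, (LinearMap.toMatrix e e (LinearMap.mulLeft F a)).diag j = 2⁻¹ * C.bil a 1 := by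
    intro j
    rw [Matrix.diag_apply, LinearMap.toMatrix_apply, he, LinearMap.mulLeft_apply]
    have h := C.bil_mul_right 1 a (e j)
    rw [one_mul, C.bil_comm 1] at h
    rw [h, ← hr j]
    ring
  simp only [this, Finset.sum_const, Finset.card_univ, Fintype.card_fin, nsmul_eq_mul]
  ring

section Casimir

variable {C} {ι : Type*} [Fintype ι] {e : ι → C.carrier} {r : ι → F}

lemma sum_map_eq (he : ∀ x, ∑ j, (r j * C.bil (e j) x) • e j = x) {M : Type*} [AddCommGroup M]
    [Module F M] (φ : C.carrier →ₗ[F] M) (x : C.carrier) :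
    ∑ j, r j • (C.bil (e j) x • φ (e j)) = φ x := by
  conv_rhs => rw [← he x, map_sum]
  simp only [map_smul, smul_smul]

lemma sum_mul_mul_mul (hr : ∀ j, r j * C.norm (e j) = 2⁻¹)
    (he : ∀ x, ∑ j, (r j * C.bil (e j) x) • e j = x) (u x : C.carrier) :
    ∑ j, r j • (e j * (u * (e j * x))) =
      (1 - (Fintype.card ι : F) * 2⁻¹) • (C.conj u * x) := by
  have h : ∀ j, r j • (e j * (u * (e j * x))) =
      r j • (C.bil (e j) (C.conj u) • (e j * x)) - (2⁻¹ : F) • (C.conj u * x) := by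
    intro j
    have h1 := C.mul_conj_mul_add (e j) (C.conj u) (e j * x)
    rw [C.conj_conj, conj_mul_mul_self, mul_smul_comm] at h1
    rw [← hr j, mul_smul, ← smul_sub, ← h1, add_sub_cancel_right]
  have h2 := sum_map_eq he (LinearMap.mulRight F x) (C.conj u)
  simp only [LinearMap.mulRight_apply] at h2
  simp only [h, Finset.sum_sub_distrib, h2, Finset.sum_const, Finset.card_univ]
  rw [← Nat.cast_smul_eq_nsmul F]
  module

lemma sum_mul_mul_conj_mul (hr : ∀ j, r j * C.norm (e j) = 2⁻¹)
    (he : ∀ x, ∑ j, (r j * C.bil (e j) x) • e j = x) (u x : C.carrier) :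
    ∑ j, r j • (e j * (u * (C.conj (e j) * x))) =
      u * x + ((Fintype.card ι : F) * 2⁻¹ - 1) • (C.conj u * x) := by
  have h1 := sum_mul_mul_mul hr he u x
  have h2 := sum_map_eq he (LinearMap.mulRight F (u * x)) 1
  simp only [LinearMap.mulRight_apply] at h2
  rw [one_mul] at h2
  have h3 : ∀ j, r j • (e j * (u * (C.conj (e j) * x))) =
      r j • (C.bil (e j) 1 • (e j * (u * x))) - r j • (e j * (u * (e j * x))) := by
    intro j
    rw [conj_eq, sub_mul, smul_mul_assoc, one_mul, mul_sub, mul_smul_comm, mul_sub,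
      mul_smul_comm, smul_sub]
  simp only [h3, Finset.sum_sub_distrib, h1, h2]
  module

end Casimir

lemma associator_left (a s z : C.carrier) :
    (s * z) * a = s * (z * a) → (a * s) * z = a * (s * z) := by
  intro h
  have h1 := congrArg C.conj (C.mul_mul_add_mul_mul (C.conj a) (C.conj z) (C.conj s))
  simp only [map_add, C.conj_mul, C.conj_conj] at h1
  have h2 := C.mul_mul_add_mul_mul a s z
  rw [mul_add] at h1
  rw [add_mul] at h2
  linear_combination (norm := module) h - h1 - h2

lemma eq_smul_one_of_conj_eq (h2 : (2 : F) ≠ 0) {x : C.carrier} (h : C.conj x = x) :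
    x = (2⁻¹ * C.bil x 1) • (1 : C.carrier) := by
  rw [conj_eq, sub_eq_iff_eq_add, ← two_smul F] at h
  rw [mul_smul, h, smul_smul, inv_mul_cancel₀ h2, one_smul]

/-- An element of the right nucleus of an octonion algebra is a scalar. -/
lemma eq_smul_one_of_mul_mul_eq (h2 : (2 : F) ≠ 0) (h3 : (3 : F) ≠ 0)
    (h8 : Module.finrank F C.carrier = 8) {a : C.carrier}
    (ha : ∀ s t, (s * t) * a = s * (t * a)) :
    a = (2⁻¹ * C.bil a 1) • (1 : C.carrier) := by
  obtain ⟨e, r, hr, he⟩ := C.exists_orthogonal_expansion h2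
  have he' : ∀ x, ∑ j, (r j * C.bil (e j) x) • e j = x := fun x => by
    simpa only [he] using e.sum_repr x
  have hcard : (Fintype.card (Fin (Module.finrank F C.carrier)) : F) * 2⁻¹ = 4 := by
    rw [Fintype.card_fin, h8]
    field_simp
    norm_num
  have ha' : ∀ s t, (a * s) * t = a * (s * t) := fun s t => C.associator_left a s t (ha s t)
  have comm : ∀ s, a * s = s * a := by
    intro s
    have h1 := sum_mul_mul_conj_mul hr he' (a * s) 1
    have h4 := sum_mul_mul_conj_mul hr he' s 1
    have h5 := sum_mul_mul_mul hr he' (C.conj s) 1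
    have h6 := sum_map_eq he' (LinearMap.mulLeft F s ∘ₗ C.conj) (C.conj a)
    simp only [mul_one, LinearMap.comp_apply, LinearMap.mulLeft_apply, C.conj_conj, hcard]
      at h1 h4 h5 h6
    have h7 : ∀ j, r j • (e j * ((a * s) * C.conj (e j))) =
        r j • (C.bil (e j) (C.conj a) • (s * C.conj (e j))) -
          C.conj a * (r j • (C.conj (e j) * (s * C.conj (e j)))) := by
      intro j
      rw [ha']
      have := C.mul_conj_mul_add (e j) (C.conj a) (s * C.conj (e j))
      rw [C.conj_conj] at this
      rw [← this, mul_smul_comm, smul_add, add_sub_cancel_right]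
    have h8 : ∑ j, r j • (C.conj (e j) * (s * C.conj (e j))) = (-3 : F) • C.conj s := by
      have h9 : ∀ j, r j • (C.conj (e j) * (s * C.conj (e j))) =
          r j • (C.bil (e j) 1 • (s * C.conj (e j))) - r j • (e j * (s * C.conj (e j))) := by
        intro j
        conv_lhs => rw [conj_eq, sub_mul, smul_mul_assoc, one_mul, ← conj_eq, smul_sub]
      have h10 := sum_map_eq he' (LinearMap.mulLeft F s ∘ₗ C.conj) 1
      simp only [LinearMap.comp_apply, LinearMap.mulLeft_apply, C.conj_one, mul_one] at h10
      simp only [h9, Finset.sum_sub_distrib, h10, h4]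
      module
    rw [Finset.sum_congr rfl fun j _ => h7 j, Finset.sum_sub_distrib, ← Finset.mul_sum, h8,
      h6] at h1
    rw [C.conj_mul, mul_smul_comm] at h1
    simp only [conj_eq, mul_sub, sub_mul, smul_mul_assoc, mul_smul_comm, mul_one, one_mul,
      smul_sub] at h1
    have h11 : (2 : F) • (a * s - s * a) = 0 := by
      linear_combination (norm := module) h1
    exact sub_eq_zero.1 ((smul_eq_zero.1 h11).resolve_left h2)
  refine C.eq_smul_one_of_conj_eq h2 ?_
  have h1 := sum_mul_mul_mul hr he' a 1
  have h4 := sum_mul_mul_mul hr he' 1 a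
  simp only [mul_one, C.conj_one, one_mul, comm, hcard] at h1 h4
  rw [h1] at h4
  have h5 : (3 : F) • (C.conj a - a) = 0 := by linear_combination (norm := module) -h4
  exact sub_eq_zero.1 ((smul_eq_zero.1 h5).resolve_left h3)

lemma eq_zero_of_mul_mul_eq (h2 : (2 : F) ≠ 0) (h3 : (3 : F) ≠ 0)
    (h8 : Module.finrank F C.carrier = 8) {a : C.carrier}
    (ha : ∀ s t, (t * s) * a = s * (t * a)) : a = 0 := by
  obtain ⟨e, r, hr, he⟩ := C.exists_orthogonal_expansion h2
  have he' : ∀ x, ∑ j, (r j * C.bil (e j) x) • e j = x := fun x => by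
    simpa only [he] using e.sum_repr x
  have hcard : (Fintype.card (Fin (Module.finrank F C.carrier)) : F) * 2⁻¹ = 4 := by
    rw [Fintype.card_fin, h8]
    field_simp
    norm_num
  have key : ∀ t, t * C.conj a = C.conj a * C.conj t := by
    intro t
    have h1 := congrArg C.conj (sum_mul_mul_conj_mul hr he' (C.conj a) (C.conj t))
    have h4 := sum_mul_mul_conj_mul hr he' (t * a) 1
    simp only [map_sum, map_smul, map_add, C.conj_mul, C.conj_conj, mul_one, hcard] at h1 h4
    have h5 : ∀ j, e j * ((t * a) * C.conj (e j)) = ((t * e j) * a) * C.conj (e j) := by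
      intro j
      rw [ha]
      have h6 := C.moufang 1 (t * a) (e j)
      rw [one_mul, one_mul] at h6
      rw [conj_eq, mul_sub, mul_sub, mul_sub, mul_smul_comm, mul_smul_comm, mul_smul_comm,
        mul_one, mul_one, h6]
    rw [Finset.sum_congr rfl fun j _ => congrArg (r j • ·) (h5 j), h1] at h4
    have h7 : (3 : F) • (t * C.conj a - C.conj a * C.conj t) = 0 := by
      linear_combination (norm := module) h4
    exact sub_eq_zero.1 ((smul_eq_zero.1 h7).resolve_left h3)
  have hconj : C.conj a = a := by
    refine C.ext_bil fun t => ?_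
    have h1 := congrArg (fun z => C.bil z 1) (key t)
    simp only [bil_mul_eq_left, mul_one, C.conj_conj] at h1
    rw [C.bil_comm _ (C.conj t), bil_conj_conj] at h1
    rw [bil_conj_left, C.bil_comm a, ← h1, C.bil_comm]
  by_contra hne
  have hs := C.eq_smul_one_of_conj_eq h2 hconj
  have hl : 2⁻¹ * C.bil a 1 ≠ 0 := fun h => hne (by rw [hs, h, zero_smul])
  have h1 : Module.finrank F C.carrier ≤ 1 := by
    refine finrank_le_one (1 : C.carrier) fun t => ⟨2⁻¹ * C.bil t 1, ?_⟩
    refine (C.eq_smul_one_of_conj_eq h2 ?_).symm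
    have ht := key t
    rw [hconj, hs, mul_smul_comm, smul_mul_assoc, mul_one, one_mul] at ht
    exact (smul_right_injective _ hl ht).symm
  omega

end CompositionAlgebra

end CompositionSums

section TensorOfCompositionAlgebras

universe u

namespace CompositionAlgebra

variable {F : Type u} [Field F] (C D : CompositionAlgebra F)

/-- The tensor product of the standard involutions. -/
def tstar : C.carrier ⊗[F] D.carrier →ₗ[F] C.carrier ⊗[F] D.carrier :=
  TensorProduct.map C.conj D.conj

/-- The standard involution of the second factor. -/
def tsharp : C.carrier ⊗[F] D.carrier →ₗ[F] C.carrier ⊗[F] D.carrier :=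
  TensorProduct.map LinearMap.id D.conj

/-- The tensor product of the polar forms of the norms. -/
def tform : LinearMap.BilinForm F (C.carrier ⊗[F] D.carrier) :=
  LinearMap.BilinForm.tmul C.bil D.bil

variable {C D}

@[simp] lemma tstar_tmul (a : C.carrier) (w : D.carrier) :
    tstar C D (a ⊗ₜ w) = C.conj a ⊗ₜ D.conj w := rfl

@[simp] lemma tsharp_tmul (a : C.carrier) (w : D.carrier) :
    tsharp C D (a ⊗ₜ w) = a ⊗ₜ D.conj w := rfl

@[simp] lemma tform_tmul (a a' : C.carrier) (w w' : D.carrier) :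
    tform C D (a ⊗ₜ w) (a' ⊗ₜ w') = C.bil a a' * D.bil w w' := by
  rw [tform, LinearMap.BilinForm.tmul, LinearMap.BilinForm.tensorDistrib_tmul, smul_eq_mul,
    mul_comm]

lemma tform_comm (x y : C.carrier ⊗[F] D.carrier) : tform C D x y = tform C D y x := by
  induction x with
  | zero => simp
  | add x x' hx hx' => simp only [map_add, LinearMap.add_apply, hx, hx']
  | tmul a w =>
    induction y with
    | zero => simp
    | add y y' hy hy' => simp only [map_add, LinearMap.add_apply, hy, hy']
    | tmul a' w' => rw [tform_tmul, tform_tmul, C.bil_comm, D.bil_comm]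

lemma tform_nondegenerate (h2 : (2 : F) ≠ 0) (x : C.carrier ⊗[F] D.carrier)
    (hx : ∀ y, tform C D x y = 0) : x = 0 := by
  obtain ⟨e, r, -, he⟩ := C.exists_orthogonal_expansion h2
  obtain ⟨f, s, -, hf⟩ := D.exists_orthogonal_expansion h2
  have key : ∀ y : C.carrier ⊗[F] D.carrier, ∀ i j,
      (e.tensorProduct f).repr y (i, j) = r i * s j * tform C D y (e i ⊗ₜ f j) := by
    intro y i j
    induction y with
    | zero => simp
    | add y y' hy hy' =>
      simp only [map_add, LinearMap.add_apply, Finsupp.add_apply, hy, hy', mul_add]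
    | tmul a w =>
      rw [Module.Basis.tensorProduct_repr_tmul_apply, tform_tmul, he, hf, C.bil_comm a,
        D.bil_comm w, smul_eq_mul]
      ring
  refine (e.tensorProduct f).repr.injective (Finsupp.ext fun ⟨i, j⟩ => ?_)
  rw [key, hx]
  simp

lemma tform_mul_left (x y z : C.carrier ⊗[F] D.carrier) :
    tform C D (x * y) z = tform C D y (tstar C D x * z) := by
  induction x with
  | zero => simp
  | add x x' hx hx' => simp only [map_add, LinearMap.add_apply, add_mul, hx, hx']
  | tmul a w =>
    induction y with
    | zero => simp
    | add y y' hy hy' => simp only [map_add, LinearMap.add_apply, mul_add, hy, hy']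
    | tmul a' w' =>
      induction z with
      | zero => simp
      | add z z' hz hz' => simp only [map_add, mul_add, hz, hz']
      | tmul b v =>
        simp only [Algebra.TensorProduct.tmul_mul_tmul, tstar_tmul, tform_tmul,
          C.bil_mul_eq_left, D.bil_mul_eq_left]

lemma tform_mul_right (x y z : C.carrier ⊗[F] D.carrier) :
    tform C D (x * y) z = tform C D x (z * tstar C D y) := by
  induction x with
  | zero => simp
  | add x x' hx hx' => simp only [map_add, LinearMap.add_apply, add_mul, hx, hx']
  | tmul a w =>
    induction y with
    | zero => simp
    | add y y' hy hy' => simp only [map_add, LinearMap.add_apply, mul_add, hy, hy']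
    | tmul a' w' =>
      induction z with
      | zero => simp
      | add z z' hz hz' => simp only [map_add, add_mul, hz, hz']
      | tmul b v =>
        simp only [Algebra.TensorProduct.tmul_mul_tmul, tstar_tmul, tform_tmul,
          C.bil_mul_eq_right, D.bil_mul_eq_right]

/-- Skew elements are sums of skew elements of the two factors. -/
lemma exists_sub_tstar_eq (x : C.carrier ⊗[F] D.carrier) :
    ∃ (s : C.carrier) (t : D.carrier), C.conj s = -s ∧ D.conj t = -t ∧
      (2 : F) • (x - tstar C D x) = s ⊗ₜ 1 + 1 ⊗ₜ t := by
  induction x with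
  | zero => exact ⟨0, 0, by simp, by simp, by simp⟩
  | add x x' hx hx' =>
    obtain ⟨s, t, hs, ht, h⟩ := hx
    obtain ⟨s', t', hs', ht', h'⟩ := hx'
    refine ⟨s + s', t + t', by rw [map_add, hs, hs', neg_add], by rw [map_add, ht, ht', neg_add],
      ?_⟩
    rw [map_add, TensorProduct.add_tmul, TensorProduct.tmul_add]
    linear_combination (norm := module) h + h'
  | tmul a w =>
    refine ⟨D.bil w 1 • (a - C.conj a), C.bil a 1 • (w - D.conj w), ?_, ?_, ?_⟩
    · rw [map_smul, map_sub, C.conj_conj, ← smul_neg, neg_sub]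
    · rw [map_smul, map_sub, D.conj_conj, ← smul_neg, neg_sub]
    · rw [tstar_tmul, C.conj_eq, D.conj_eq]
      simp only [TensorProduct.sub_tmul, TensorProduct.tmul_sub, ← TensorProduct.smul_tmul',
        TensorProduct.tmul_smul]
      module

lemma exists_eq_of_tstar_eq_neg (h2 : (2 : F) ≠ 0) {x : C.carrier ⊗[F] D.carrier}
    (hx : tstar C D x = -x) :
    ∃ (s : C.carrier) (t : D.carrier), C.conj s = -s ∧ D.conj t = -t ∧ x = s ⊗ₜ 1 + 1 ⊗ₜ t := by
  have h4 : (4 : F) ≠ 0 := by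
    rw [show (4 : F) = 2 * 2 by norm_num]; exact mul_ne_zero h2 h2
  obtain ⟨s, t, hs, ht, h⟩ := exists_sub_tstar_eq x
  refine ⟨(4 : F)⁻¹ • s, (4 : F)⁻¹ • t, by rw [map_smul, hs, smul_neg],
    by rw [map_smul, ht, smul_neg], ?_⟩
  rw [← TensorProduct.smul_tmul', TensorProduct.tmul_smul, ← smul_add, ← h, hx, sub_neg_eq_add,
    ← two_smul F, smul_smul, smul_smul, mul_assoc, show (2 * 2 : F) = 4 by norm_num,
    inv_mul_cancel₀ h4, one_smul]

lemma bil_one_eq_zero (h2 : (2 : F) ≠ 0) {s : C.carrier} (hs : C.conj s = -s) :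
    C.bil s 1 = 0 := by
  have h := C.bil_conj_one s
  rw [hs, map_neg, LinearMap.neg_apply] at h
  have h' : 2 * C.bil s 1 = 0 := by linear_combination -h
  exact (mul_eq_zero.1 h').resolve_left h2

lemma mul_mul_of_conj_eq_neg {s : C.carrier} (hs : C.conj s = -s) (x : C.carrier) :
    s * (s * x) = -(C.norm s • x) := by
  have h := C.conj_mul_mul_self s x
  rw [hs, neg_mul] at h
  rw [← h, neg_neg]

lemma tform_tsharp_self (h2 : (2 : F) ≠ 0) {s : C.carrier} {t : D.carrier} (hs : C.conj s = -s)
    (ht : D.conj t = -t) :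
    tform C D (s ⊗ₜ 1 + 1 ⊗ₜ t) (tsharp C D (s ⊗ₜ 1 + 1 ⊗ₜ t)) =
      4 * (C.norm s - D.norm t) := by
  have h1 := bil_one_eq_zero h2 hs
  simp only [map_add, LinearMap.add_apply, tsharp_tmul, D.conj_one, ht, tform_tmul, C.bil_self,
    D.bil_self, D.norm_one, C.norm_one, map_neg, h1, C.bil_comm 1 s]
  ring

lemma mul_tsharp_mul (h2 : (2 : F) ≠ 0) {x : C.carrier ⊗[F] D.carrier}
    (hx : tstar C D x = -x) (y : C.carrier ⊗[F] D.carrier) :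
    (4 : F) • (x * (tsharp C D x * y)) = -(tform C D x (tsharp C D x) • y) := by
  obtain ⟨s, t, hs, ht, rfl⟩ := exists_eq_of_tstar_eq_neg h2 hx
  rw [tform_tsharp_self h2 hs ht]
  induction y with
  | zero => simp
  | add y y' hy hy' => simp only [mul_add, smul_add, hy, hy', neg_add]
  | tmul a w =>
    simp only [map_add, tsharp_tmul, D.conj_one, ht, add_mul, mul_add, one_mul,
      Algebra.TensorProduct.tmul_mul_tmul, mul_mul_of_conj_eq_neg hs, neg_mul, mul_neg,
      mul_mul_of_conj_eq_neg ht, TensorProduct.tmul_neg, TensorProduct.neg_tmul,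
      TensorProduct.tmul_smul, ← TensorProduct.smul_tmul']
    module

lemma tsharp_mul_mul (h2 : (2 : F) ≠ 0) {x : C.carrier ⊗[F] D.carrier}
    (hx : tstar C D x = -x) (y : C.carrier ⊗[F] D.carrier) :
    (4 : F) • (tsharp C D x * (x * y)) = -(tform C D x (tsharp C D x) • y) := by
  obtain ⟨s, t, hs, ht, rfl⟩ := exists_eq_of_tstar_eq_neg h2 hx
  rw [tform_tsharp_self h2 hs ht]
  induction y with
  | zero => simp
  | add y y' hy hy' => simp only [mul_add, smul_add, hy, hy', neg_add]
  | tmul a w =>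
    simp only [map_add, tsharp_tmul, D.conj_one, ht, add_mul, mul_add, one_mul,
      Algebra.TensorProduct.tmul_mul_tmul, mul_mul_of_conj_eq_neg hs, neg_mul,
      mul_mul_of_conj_eq_neg ht, TensorProduct.tmul_neg, TensorProduct.neg_tmul,
      TensorProduct.tmul_smul, ← TensorProduct.smul_tmul']
    module

lemma tform_tsharp_left (x y : C.carrier ⊗[F] D.carrier) :
    tform C D (tsharp C D x) y = tform C D x (tsharp C D y) := by
  induction x with
  | zero => simp
  | add x x' hx hx' => simp only [map_add, LinearMap.add_apply, hx, hx']
  | tmul a w =>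
    induction y with
    | zero => simp
    | add y y' hy hy' => simp only [map_add, hy, hy']
    | tmul a' w' => simp only [tsharp_tmul, tform_tmul, D.bil_conj_left]

lemma tsharp_tsharp (x : C.carrier ⊗[F] D.carrier) : tsharp C D (tsharp C D x) = x := by
  induction x with
  | zero => simp
  | add x x' hx hx' => simp only [map_add, hx, hx']
  | tmul a w => simp only [tsharp_tmul, D.conj_conj]

lemma tstar_tstar (x : C.carrier ⊗[F] D.carrier) : tstar C D (tstar C D x) = x := by
  induction x with
  | zero => simp
  | add x x' hx hx' => simp only [map_add, hx, hx']
  | tmul a w => simp only [tstar_tmul, C.conj_conj, D.conj_conj]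

lemma tstar_tsharp (x : C.carrier ⊗[F] D.carrier) :
    tstar C D (tsharp C D x) = tsharp C D (tstar C D x) := by
  induction x with
  | zero => simp
  | add x x' hx hx' => simp only [map_add, hx, hx']
  | tmul a w => simp only [tstar_tmul, tsharp_tmul]

/-- The trace of a left multiplication is a multiple of the linear form defined by the unit. -/
lemma trace_mulLeft_tensor (h2 : (2 : F) ≠ 0) (x : C.carrier ⊗[F] D.carrier) :
    LinearMap.trace F _ (LinearMap.mulLeft F x) =
      (Module.finrank F C.carrier * 2⁻¹) * (Module.finrank F D.carrier * 2⁻¹) *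
        tform C D x 1 := by
  induction x with
  | zero => simp
  | add x x' hx hx' =>
    have : LinearMap.mulLeft F (x + x') = LinearMap.mulLeft F x + LinearMap.mulLeft F x' := by
      ext; simp [add_mul]
    rw [this, map_add, hx, hx', map_add, LinearMap.add_apply, mul_add]
  | tmul a w =>
    have : LinearMap.mulLeft F (a ⊗ₜ[F] w) =
        TensorProduct.map (LinearMap.mulLeft F a) (LinearMap.mulLeft F w) := by
      ext; simp
    rw [this, LinearMap.trace_tensorProduct', C.trace_mulLeft h2, D.trace_mulLeft h2,
      Algebra.TensorProduct.one_def, tform_tmul]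
    ring

end CompositionAlgebra

end TensorOfCompositionAlgebras

section StructurableIdentities

universe u

namespace CompositionAlgebra

variable {F : Type u} [Field F] {C D : CompositionAlgebra F}

lemma mul_mul_add_mul_mul_conj (s x y : C.carrier) :
    (x * C.conj y) * s + s * (x * C.conj y) = x * (C.conj y * s) + (s * x) * C.conj y := by
  have h := C.mul_mul_add_flexible x (C.conj y) s
  have h' := C.mul_mul_add_mul_mul x (C.conj y) s
  rw [add_mul] at h'
  linear_combination (norm := module) h - h'

lemma mul_conj_mul_mul_sub (s x y z : C.carrier) :
    (x * C.conj y) * (s * z) - s * ((y * C.conj x) * z) =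
      (x * (C.conj y * s)) * z - ((s * y) * C.conj x) * z := by
  have h1 := congrArg (· * z) (C.mul_mul_add_mul_mul_conj s x y)
  have h2 := C.mul_mul_add_mul_mul (x * C.conj y) s z
  have h3 := congrArg (fun t => s * (t * z)) (C.mul_conj_add x y)
  have h4 := congrArg (· * z) (C.mul_mul_conj_add x y s)
  simp only [add_mul, mul_add, smul_mul_assoc, one_mul, mul_smul_comm] at h1 h2 h3 h4
  linear_combination (norm := module) h1 + h2 - h3 + h4

lemma mul_mul_conj_mul_add_sub (s x y z : C.carrier) :
    ((s * z) * C.conj y) * x + s * ((y * C.conj x) * z) - s * ((z * C.conj y) * x) =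
      ((s * y) * C.conj x) * z := by
  have h1 := C.moufang_add' s (C.conj x) y z
  have h2 := C.mul_conj_mul_add' x y (s * z)
  have h3 := congrArg (s * ·) (C.mul_conj_mul_add' x y z)
  simp only [mul_add, mul_smul_comm] at h3
  linear_combination (norm := module) h2 - h3 - h1

lemma mul_mul_conj_mul_add (s x y z : C.carrier) :
    ((s * z) * C.conj y) * x + ((s * z) * C.conj x) * y =
      s * ((z * C.conj x) * y) + s * ((z * C.conj y) * x) := by
  have h2 := C.mul_conj_mul_add' x y (s * z)
  have h3 := congrArg (s * ·) (C.mul_conj_mul_add' x y z)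
  simp only [mul_add, mul_smul_comm] at h3
  linear_combination (norm := module) h2 - h3

/-- The operator `V_{x,y}` on the tensor product of two composition algebras. -/
def tV (x y z : C.carrier ⊗[F] D.carrier) : C.carrier ⊗[F] D.carrier :=
  (x * tstar C D y) * z + (z * tstar C D y) * x - (z * tstar C D x) * y

lemma tV_mul_left_tmul (s a b c : C.carrier) (u v w : D.carrier) :
    tV (a ⊗ₜ[F] u) (b ⊗ₜ[F] v) (s ⊗ₜ 1 * c ⊗ₜ w) +
        s ⊗ₜ 1 * tV (b ⊗ₜ[F] v) (a ⊗ₜ[F] u) (c ⊗ₜ w) =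
      ((a ⊗ₜ[F] u) * (tstar C D (b ⊗ₜ[F] v) * s ⊗ₜ 1)) * c ⊗ₜ w +
        ((s ⊗ₜ 1 * (b ⊗ₜ[F] v)) * tstar C D (a ⊗ₜ[F] u)) * c ⊗ₜ w := by
  have p : (v * D.conj u) * w = D.bil u v • w - (u * D.conj v) * w := by
    have := congrArg (· * w) (D.mul_conj_add u v)
    simp only [add_mul, smul_mul_assoc, one_mul] at this
    rw [← this, add_sub_cancel_left]
  have q : (w * D.conj v) * u = D.bil u v • w - (w * D.conj u) * v := by
    rw [← D.mul_conj_mul_add' u v w, add_sub_cancel_left]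
  have h1 := congrArg (fun t => t ⊗ₜ[F] ((u * D.conj v) * w)) (C.mul_conj_mul_mul_sub s a b c)
  have h2 := congrArg (fun t => t ⊗ₜ[F] (D.bil u v • w)) (C.mul_mul_conj_mul_add_sub s a b c)
  have h3 := congrArg (fun t => t ⊗ₜ[F] ((w * D.conj u) * v)) (C.mul_mul_conj_mul_add s a b c)
  simp only [TensorProduct.add_tmul, TensorProduct.sub_tmul] at h1 h2 h3
  simp only [tV, tstar_tmul, Algebra.TensorProduct.tmul_mul_tmul, mul_add, mul_sub, one_mul,
    mul_one, p, q, TensorProduct.tmul_sub]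
  linear_combination (norm := module) h1 + h2 - h3

lemma tV_mul_right_tmul (t : D.carrier) (a b c : C.carrier) (u v w : D.carrier) :
    tV (a ⊗ₜ[F] u) (b ⊗ₜ[F] v) (1 ⊗ₜ t * c ⊗ₜ w) +
        1 ⊗ₜ t * tV (b ⊗ₜ[F] v) (a ⊗ₜ[F] u) (c ⊗ₜ w) =
      ((a ⊗ₜ[F] u) * (tstar C D (b ⊗ₜ[F] v) * 1 ⊗ₜ t)) * c ⊗ₜ w +
        ((1 ⊗ₜ t * (b ⊗ₜ[F] v)) * tstar C D (a ⊗ₜ[F] u)) * c ⊗ₜ w := by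
  have p : (b * C.conj a) * c = C.bil a b • c - (a * C.conj b) * c := by
    have := congrArg (· * c) (C.mul_conj_add a b)
    simp only [add_mul, smul_mul_assoc, one_mul] at this
    rw [← this, add_sub_cancel_left]
  have q : (c * C.conj b) * a = C.bil a b • c - (c * C.conj a) * b := by
    rw [← C.mul_conj_mul_add' a b c, add_sub_cancel_left]
  have h1 := congrArg (fun z => ((a * C.conj b) * c) ⊗ₜ[F] z) (D.mul_conj_mul_mul_sub t u v w)
  have h2 := congrArg (fun z => (C.bil a b • c) ⊗ₜ[F] z) (D.mul_mul_conj_mul_add_sub t u v w)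
  have h3 := congrArg (fun z => ((c * C.conj a) * b) ⊗ₜ[F] z) (D.mul_mul_conj_mul_add t u v w)
  simp only [TensorProduct.tmul_add, TensorProduct.tmul_sub] at h1 h2 h3
  simp only [tV, tstar_tmul, Algebra.TensorProduct.tmul_mul_tmul, mul_add, mul_sub, one_mul,
    mul_one, p, q, TensorProduct.sub_tmul]
  linear_combination (norm := module) h1 + h2 - h3

lemma tV_skew_mul (h2 : (2 : F) ≠ 0) {s : C.carrier ⊗[F] D.carrier} (hs : tstar C D s = -s)
    (x y z : C.carrier ⊗[F] D.carrier) :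
    tV x y (s * z) + s * tV y x z =
      (x * (tstar C D y * s)) * z + ((s * y) * tstar C D x) * z := by
  obtain ⟨s, t, -, -, rfl⟩ := exists_eq_of_tstar_eq_neg h2 hs
  induction x with
  | zero => simp [tV]
  | add x x' hx hx' =>
    simp only [tV, map_add, add_mul, mul_add, mul_sub] at hx hx' ⊢
    linear_combination (norm := abel) hx + hx'
  | tmul a u =>
    induction y with
    | zero => simp [tV]
    | add y y' hy hy' =>
      simp only [tV, map_add, add_mul, mul_add, mul_sub] at hy hy' ⊢
      linear_combination (norm := abel) hy + hy'
    | tmul b v =>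
      induction z with
      | zero => simp [tV]
      | add z z' hz hz' =>
        simp only [tV, add_mul, mul_add, mul_sub] at hz hz' ⊢
        linear_combination (norm := abel) hz + hz'
      | tmul c w =>
        have h := tV_mul_left_tmul s a b c u v w
        have h' := tV_mul_right_tmul t a b c u v w
        simp only [tV, add_mul, mul_add, mul_sub] at h h' ⊢
        linear_combination (norm := abel) h + h'

end CompositionAlgebra

end StructurableIdentities

section SchurLemma

universe u

namespace CompositionAlgebra

variable {F : Type u} [Field F] {C D : CompositionAlgebra F}

/-- Apply a linear form to the second factor. -/
def contract (φ : Module.Dual F D.carrier) : C.carrier ⊗[F] D.carrier →ₗ[F] C.carrier :=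
  (TensorProduct.rid F C.carrier).toLinearMap ∘ₗ LinearMap.lTensor C.carrier φ

@[simp] lemma contract_tmul (φ : Module.Dual F D.carrier) (a : C.carrier) (w : D.carrier) :
    contract φ (a ⊗ₜ w) = φ w • a := by
  simp [contract]

lemma contract_tmul_one_mul (φ : Module.Dual F D.carrier) (a : C.carrier)
    (x : C.carrier ⊗[F] D.carrier) : contract φ (a ⊗ₜ 1 * x) = a * contract φ x := by
  induction x with
  | zero => simp
  | add x x' hx hx' => rw [mul_add, map_add, hx, hx', map_add, mul_add]
  | tmul b w => simp [mul_smul_comm]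

lemma sum_contract_tmul {ι : Type*} [Fintype ι] (f : Module.Basis ι F D.carrier)
    (x : C.carrier ⊗[F] D.carrier) : ∑ i, contract (f.coord i) x ⊗ₜ[F] f i = x := by
  induction x with
  | zero => simp
  | add x x' hx hx' =>
    simp only [map_add, TensorProduct.add_tmul, Finset.sum_add_distrib, hx, hx']
  | tmul a w =>
    conv_rhs => rw [← f.sum_repr w, TensorProduct.tmul_sum]
    simp [TensorProduct.smul_tmul]

lemma eq_smul_add_of_conj (h2 : (2 : F) ≠ 0) (a : C.carrier) :
    ∃ (α : F) (s : C.carrier), C.conj s = -s ∧ a = α • (1 : C.carrier) + s := by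
  refine ⟨2⁻¹ * C.bil a 1, (2⁻¹ : F) • (a - C.conj a), ?_, ?_⟩
  · rw [map_smul, map_sub, C.conj_conj, ← smul_neg, neg_sub]
  · have h : (2 : F)⁻¹ * 2 = 1 := inv_mul_cancel₀ h2
    have h' : a = ((2 : F)⁻¹ * 2) • a := by rw [h, one_smul]
    rw [C.conj_eq]
    conv_lhs => rw [h']
    module

lemma tstar_tmul_one {s : C.carrier} (hs : C.conj s = -s) :
    tstar C D (s ⊗ₜ 1) = -(s ⊗ₜ 1) := by
  rw [tstar_tmul, hs, D.conj_one, TensorProduct.neg_tmul]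

lemma tstar_one_tmul {t : D.carrier} (ht : D.conj t = -t) :
    tstar C D (1 ⊗ₜ t) = -(1 ⊗ₜ t) := by
  rw [tstar_tmul, ht, C.conj_one, TensorProduct.tmul_neg]

/-- A pair of adjoint operators intertwining the left multiplications by skew elements is
scalar. -/
lemma exists_eq_smul_of_intertwining (h2 : (2 : F) ≠ 0) (h3 : (3 : F) ≠ 0)
    (h8 : Module.finrank F C.carrier = 8)
    (T T' : C.carrier ⊗[F] D.carrier →ₗ[F] C.carrier ⊗[F] D.carrier)
    (hT : ∀ s x, tstar C D s = -s → s * T x = T' (s * x))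
    (hT' : ∀ s x, tstar C D s = -s → T (s * x) = s * T' x)
    (hadj : ∀ x y, tform C D (T x) y = tform C D x (T' y)) :
    ∃ l : F, ∀ x, T x = l • x := by
  have hE : ∀ (s : C.carrier) x, (T + T') (s ⊗ₜ 1 * x) = s ⊗ₜ 1 * (T + T') x := by
    intro s x
    obtain ⟨α, s, hs, rfl⟩ := eq_smul_add_of_conj h2 s
    have h := hT _ x (tstar_tmul_one (D := D) hs)
    have h' := hT' _ x (tstar_tmul_one (D := D) hs)
    simp only [TensorProduct.add_tmul, ← TensorProduct.smul_tmul', ← Algebra.TensorProduct.one_def,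
      add_mul, smul_mul_assoc, one_mul, map_add, map_smul, LinearMap.add_apply, mul_add, h, h']
    module
  have hE' : ∀ (t : D.carrier) x, (T + T') (1 ⊗ₜ t * x) = 1 ⊗ₜ t * (T + T') x := by
    intro s x
    obtain ⟨α, s, hs, rfl⟩ := eq_smul_add_of_conj h2 s
    have h := hT _ x (tstar_one_tmul (C := C) hs)
    have h' := hT' _ x (tstar_one_tmul (C := C) hs)
    simp only [TensorProduct.tmul_add, TensorProduct.tmul_smul, ← Algebra.TensorProduct.one_def,
      add_mul, smul_mul_assoc, one_mul, map_add, map_smul, LinearMap.add_apply, mul_add, h, h']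
    module
  have hD : ∀ (s : C.carrier) x, (T - T') (s ⊗ₜ 1 * x) = C.conj s ⊗ₜ 1 * (T - T') x := by
    intro s x
    obtain ⟨α, s, hs, rfl⟩ := eq_smul_add_of_conj h2 s
    have h := hT _ x (tstar_tmul_one (D := D) hs)
    have h' := hT' _ x (tstar_tmul_one (D := D) hs)
    simp only [map_add, map_smul, C.conj_one, hs, TensorProduct.add_tmul, TensorProduct.neg_tmul,
      ← TensorProduct.smul_tmul', ← Algebra.TensorProduct.one_def,
      add_mul, smul_mul_assoc, one_mul, LinearMap.sub_apply, neg_mul, mul_sub, h, h']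
    module
  have hD' : ∀ (t : D.carrier) x, (T - T') (1 ⊗ₜ t * x) = 1 ⊗ₜ D.conj t * (T - T') x := by
    intro s x
    obtain ⟨α, s, hs, rfl⟩ := eq_smul_add_of_conj h2 s
    have h := hT _ x (tstar_one_tmul (C := C) hs)
    have h' := hT' _ x (tstar_one_tmul (C := C) hs)
    simp only [map_add, map_smul, D.conj_one, hs, TensorProduct.tmul_add, TensorProduct.tmul_neg,
      TensorProduct.tmul_smul, ← Algebra.TensorProduct.one_def,
      add_mul, smul_mul_assoc, one_mul, LinearMap.sub_apply, neg_mul, mul_sub, h, h']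
    module
  have f := Module.finBasis F D.carrier
  have hd : (T - T') 1 = 0 := by
    rw [← sum_contract_tmul f ((T - T') 1)]
    refine Finset.sum_eq_zero fun i _ => ?_
    rw [C.eq_zero_of_mul_mul_eq h2 h3 h8 (a := contract (f.coord i) ((T - T') 1)) fun s t => ?_,
      TensorProduct.zero_tmul]
    rw [← contract_tmul_one_mul, ← contract_tmul_one_mul, ← contract_tmul_one_mul]
    have h := hD (C.conj s) (C.conj t ⊗ₜ 1)
    have h' := hD (C.conj t) 1
    have hh := hD (C.conj s * C.conj t) 1
    rw [Algebra.TensorProduct.tmul_mul_tmul, C.conj_conj, mul_one] at h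
    rw [mul_one, C.conj_conj] at h'
    rw [mul_one, C.conj_mul, C.conj_conj, C.conj_conj] at hh
    rw [← hh, h, h']
  have he : ∃ w, (T + T') 1 = 1 ⊗ₜ w := by
    refine ⟨∑ i, (2⁻¹ * C.bil (contract (f.coord i) ((T + T') 1)) 1) • f i, ?_⟩
    conv_lhs => rw [← sum_contract_tmul f ((T + T') 1)]
    rw [TensorProduct.tmul_sum]
    refine Finset.sum_congr rfl fun i _ => ?_
    rw [← TensorProduct.smul_tmul]
    congr 1
    refine C.eq_smul_one_of_mul_mul_eq h2 h3 h8 fun s t => ?_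
    rw [← contract_tmul_one_mul, ← contract_tmul_one_mul, ← contract_tmul_one_mul]
    have h := hE s (t ⊗ₜ 1)
    have h' := hE t 1
    have hh := hE (s * t) 1
    rw [Algebra.TensorProduct.tmul_mul_tmul, mul_one] at h
    rw [mul_one] at h' hh
    rw [← hh, h, h']
  obtain ⟨w, hw⟩ := he
  have hself : ∀ x y, tform C D ((T + T') x) y = tform C D x ((T + T') y) := by
    intro x y
    have h := hadj y x
    rw [tform_comm, tform_comm y] at h
    rw [LinearMap.add_apply, LinearMap.add_apply, map_add, map_add, LinearMap.add_apply, hadj,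
      h, add_comm]
  have hconj : D.conj w = w := by
    refine D.ext_bil fun t => ?_
    have h := hself 1 (1 ⊗ₜ t)
    have h' := hE' t 1
    rw [mul_one] at h'
    rw [h', hw, Algebra.TensorProduct.tmul_mul_tmul, mul_one, Algebra.TensorProduct.one_def,
      tform_tmul, tform_tmul, C.bil_one_one, D.bil_comm 1, D.bil_mul_eq_left, mul_one] at h
    rw [D.bil_conj_left, mul_left_cancel₀ h2 h]
  have hw' := D.eq_smul_one_of_conj_eq h2 hconj
  have hsum : ∀ x, (T + T') x = (2⁻¹ * D.bil w 1) • x := by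
    intro x
    induction x with
    | zero => simp
    | add x y hx hy => rw [map_add, hx, hy, smul_add]
    | tmul s t =>
      have h : s ⊗ₜ[F] t = s ⊗ₜ 1 * (1 ⊗ₜ t * 1) := by simp
      rw [h, hE, hE', hw, hw', TensorProduct.tmul_smul, ← Algebra.TensorProduct.one_def,
        mul_smul_comm, mul_smul_comm, ← hw']
  have hdiff : ∀ x, (T - T') x = 0 := by
    intro x
    induction x with
    | zero => simp
    | add x y hx hy => rw [map_add, hx, hy, add_zero]
    | tmul s t =>
      have h : s ⊗ₜ[F] t = s ⊗ₜ 1 * (1 ⊗ₜ t * 1) := by simp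
      rw [h, hD, hD', hd, mul_zero, mul_zero]
  refine ⟨2⁻¹ * (2⁻¹ * D.bil w 1), fun x => ?_⟩
  have h : (2 : F) • T x = (2⁻¹ * D.bil w 1) • x := by
    rw [← hsum, LinearMap.add_apply, ← sub_eq_zero.1 (hdiff x), two_smul]
  rw [mul_smul, ← h, smul_smul, inv_mul_cancel₀ h2, one_smul]

end CompositionAlgebra

end SchurLemma

section Descent

universe u

namespace CompositionAlgebra

variable {F : Type u} [Field F] {C D : CompositionAlgebra F}

lemma tform_tstar_tstar (x y : C.carrier ⊗[F] D.carrier) :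
    tform C D (tstar C D x) (tstar C D y) = tform C D x y := by
  induction x with
  | zero => simp
  | add x x' hx hx' => simp only [map_add, LinearMap.add_apply, hx, hx']
  | tmul a w =>
    induction y with
    | zero => simp
    | add y y' hy hy' => simp only [map_add, hy, hy']
    | tmul a' w' => simp only [tstar_tmul, tform_tmul, C.bil_conj_conj, D.bil_conj_conj]

lemma tform_sub_tstar {u : C.carrier ⊗[F] D.carrier} (hu : tstar C D u = -u)
    (y : C.carrier ⊗[F] D.carrier) :
    tform C D u (y - tstar C D y) = 2 * tform C D u y := by
  have h := tform_tstar_tstar u y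
  rw [hu, map_neg, LinearMap.neg_apply] at h
  rw [map_sub]
  linear_combination h

lemma finrank_le_one_of_conj (h2 : (2 : F) ≠ 0) (h : ∀ x, C.conj x = x) :
    Module.finrank F C.carrier ≤ 1 :=
  finrank_le_one (1 : C.carrier) fun t => ⟨2⁻¹ * C.bil t 1, (C.eq_smul_one_of_conj_eq h2 (h t)).symm⟩

lemma exists_skew_norm_ne_zero (h2 : (2 : F) ≠ 0) (h8 : Module.finrank F C.carrier = 8) :
    ∃ s, C.conj s = -s ∧ C.norm s ≠ 0 := by
  by_contra! hn
  have hp : ∀ x, C.conj x = x := by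
    intro x
    refine (sub_eq_zero.1 (C.ext_bil (y := 0) fun y => ?_)).symm
    obtain ⟨α, t, ht, rfl⟩ := eq_smul_add_of_conj h2 y
    have hs : C.conj (x - C.conj x) = -(x - C.conj x) := by
      rw [map_sub, C.conj_conj, neg_sub]
    have h := C.norm_add (x - C.conj x) t
    rw [hn _ hs, hn _ ht, hn _ (by rw [map_add, hs, ht, neg_add])] at h
    rw [map_add, map_smul, bil_one_eq_zero h2 hs, smul_zero, zero_add, map_zero,
      LinearMap.zero_apply]
    simpa using h.symm
  have := finrank_le_one_of_conj h2 hp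
  omega

end CompositionAlgebra

namespace ProductAlgebraSplitting

open CompositionAlgebra

variable {k : Type u} [Field k] {A : AlgebraWithInvolution k} {m₁ m₂ : ℕ}
  (P : ProductAlgebraSplitting A m₁ m₂)

/-- The underlying linear equivalence of the splitting. -/
def equiv : P.K ⊗[k] A.carrier ≃ₗ[P.K] P.C₁.carrier ⊗[P.K] P.C₂.carrier :=
  P.iso.toLinearEquiv

lemma equiv_mul (x y : P.K ⊗[k] A.carrier) : P.equiv (x * y) = P.equiv x * P.equiv y :=
  P.iso.map_mul x y

lemma equiv_one : P.equiv 1 = 1 := P.iso.map_one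

lemma equiv_invol (x : P.K ⊗[k] A.carrier) :
    P.equiv (A.invol.baseChange P.K x) = tstar P.C₁ P.C₂ (P.equiv x) :=
  P.iso.map_invol x

/-- The embedding of the algebra into its split form. -/
def emb (a : A) : P.C₁.carrier ⊗[P.K] P.C₂.carrier := P.equiv (1 ⊗ₜ a)

lemma emb_add (a b : A) : P.emb (a + b) = P.emb a + P.emb b := by
  rw [emb, TensorProduct.tmul_add, map_add]; rfl

lemma emb_smul (c : k) (a : A) : P.emb (c • a) = algebraMap k P.K c • P.emb a := by
  rw [emb, emb, ← map_smul, TensorProduct.smul_tmul', ← TensorProduct.smul_tmul,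
    Algebra.smul_def, smul_eq_mul]

lemma emb_neg (a : A) : P.emb (-a) = -P.emb a := by
  rw [emb, TensorProduct.tmul_neg, map_neg]; rfl

lemma emb_sub (a b : A) : P.emb (a - b) = P.emb a - P.emb b := by
  rw [emb, TensorProduct.tmul_sub, map_sub]; rfl

lemma emb_mul (a b : A) : P.emb (a * b) = P.emb a * P.emb b := by
  rw [emb, emb, emb, ← equiv_mul, Algebra.TensorProduct.tmul_mul_tmul, one_mul]

lemma emb_one : P.emb 1 = 1 := P.equiv_one

lemma emb_invol (a : A) : P.emb (A.invol a) = tstar P.C₁ P.C₂ (P.emb a) := by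
  rw [emb, emb, ← equiv_invol, LinearMap.baseChange_tmul]

lemma emb_injective : Function.Injective P.emb :=
  P.equiv.injective.comp (Module.FaithfullyFlat.tensorProduct_mk_injective A.carrier)

lemma emb_induction {p : P.C₁.carrier ⊗[P.K] P.C₂.carrier → Prop}
    (hs : ∀ (c : P.K) (a : A), p (c • P.emb a)) (ha : ∀ x y, p x → p y → p (x + y)) (x) : p x := by
  obtain ⟨x, rfl⟩ := P.equiv.surjective x
  induction x with
  | zero => simpa using hs 0 0
  | add x y hx hy => rw [map_add]; exact ha _ _ hx hy
  | tmul c a =>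
    have := hs c a
    rwa [emb, ← map_smul, TensorProduct.smul_tmul', smul_eq_mul, mul_one] at this

/-- The extension of a linear endomorphism to the split form. -/
def extend (T : A.carrier →ₗ[k] A.carrier) :
    P.C₁.carrier ⊗[P.K] P.C₂.carrier →ₗ[P.K] P.C₁.carrier ⊗[P.K] P.C₂.carrier :=
  P.equiv.conj (T.baseChange P.K)

lemma extend_emb (T : A.carrier →ₗ[k] A.carrier) (a : A) :
    P.extend T (P.emb a) = P.emb (T a) := by
  rw [extend, LinearEquiv.conj_apply_apply, emb, LinearEquiv.symm_apply_apply,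
    LinearMap.baseChange_tmul, emb]

lemma finrank_eq (P : ProductAlgebraSplitting A m₁ m₂) : Module.finrank k A.carrier = m₁ * m₂ := by
  rw [← Module.finrank_baseChange (R := P.K), P.equiv.finrank_eq, Module.finrank_tensorProduct,
    P.finrank₁, P.finrank₂]

lemma extend_mulLeft (a : A) :
    P.extend (LinearMap.mulLeft k a) = LinearMap.mulLeft P.K (P.emb a) := by
  refine LinearMap.ext fun x => ?_
  induction x using P.emb_induction with
  | hs c b => rw [map_smul, map_smul, extend_emb, LinearMap.mulLeft_apply, emb_mul,
      LinearMap.mulLeft_apply]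
  | ha x y hx hy => rw [map_add, hx, hy, map_add]

end ProductAlgebraSplitting

end Descent

section AlbertData

universe u

namespace AlgebraWithInvolution

variable {k : Type u} [Field k] (A : AlgebraWithInvolution k)

/-- The trace form `(x, y) ↦ tr (L_{x ȳ})`. -/
noncomputable def traceForm : LinearMap.BilinForm k A.carrier :=
  ((LinearMap.mul k A.carrier).compl₂ A.invol).compr₂
    (LinearMap.trace k A.carrier ∘ₗ LinearMap.mul k A.carrier)

lemma traceForm_apply (x y : A) :
    A.traceForm x y = LinearMap.trace k A.carrier (LinearMap.mulLeft k (x * A.invol y)) := rfl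

variable {A}

lemma mem_skew {s : A} : s ∈ A.skew ↔ A.invol s = -s := Iff.rfl

lemma invol_coe (s : A.skew) : A.invol s = -s := s.2

lemma psi_mem_skew (x y : A) : A.psi x y ∈ A.skew := by
  rw [mem_skew, psi, map_sub, A.invol_mul, A.invol_mul, A.invol_invol, A.invol_invol, neg_sub]

/-- The map `ψ` with values in the skew elements. -/
def skewPsi (x y : A) : A.skew := ⟨A.psi x y, psi_mem_skew x y⟩

@[simp] lemma coe_skewPsi (x y : A) : (A.skewPsi x y : A) = A.psi x y := rfl

end AlgebraWithInvolution

open AlgebraWithInvolution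

/-- The properties of a product algebra with an octonion factor, of its Albert form and of its
trace form that determine the isotopies. -/
structure AlbertForm.IsRegular {k : Type u} [Field k] {A : AlgebraWithInvolution k}
    (Φ : AlbertForm A) (n : ℕ) (κ : k) : Prop where
  finite : Module.Finite k A.carrier
  finrank_eq : Module.finrank k A.carrier = n
  three_le_finrank_skew : 3 ≤ Module.finrank k A.skew
  ne_zero : κ ≠ 0
  form_comm : ∀ x y : A, A.traceForm x y = A.traceForm y x
  form_nondegenerate : ∀ x : A, (∀ y, A.traceForm x y = 0) → x = 0
  form_mul : ∀ x y z : A, A.traceForm (x * y) z = A.traceForm y (A.invol x * z)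
  polar_nondegenerate : ∀ s, (∀ t, QuadraticMap.polar Φ.Q s t = 0) → s = 0
  natMap_injective : Function.Injective Φ.natMap
  exists_ne_zero : ∃ s, Φ.Q s ≠ 0
  natMap_mul : ∀ (s : A.skew) (a : A), (Φ.natMap s : A) * (s * a) = -(Φ.Q s) • a
  form_natMap : ∀ (s : A.skew) (x z : A),
    A.traceForm (Φ.natMap s * x) z = κ * QuadraticMap.polar Φ.Q s (A.skewPsi x z)
  Vop_skew_mul : ∀ (s : A.skew) (x y z : A),
    A.Vop x y (s * z) + s * A.Vop y x z = -(A.psi x (s * y) * z)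
  schur : ∀ T T' : A.carrier →ₗ[k] A.carrier,
    (∀ (s : A.skew) (x : A), s * T x = T' (s * x)) →
    (∀ (s : A.skew) (x : A), T (s * x) = s * T' x) →
    (∀ x y, A.traceForm (T x) y = A.traceForm x (T' y)) → ∃ l : k, ∀ x, T x = l • x

namespace ProductAlgebraSplitting

open CompositionAlgebra

variable {k : Type u} [Field k] {A : AlgebraWithInvolution k} {m : ℕ}
  (P : ProductAlgebraSplitting A 8 m)

lemma finite (P : ProductAlgebraSplitting A 8 m) (hm : 0 < m) : Module.Finite k A.carrier := by
  refine Module.finite_of_finrank_pos ?_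
  rw [P.finrank_eq]
  omega

lemma two_ne_zero_splitting (hk2 : (2 : k) ≠ 0) : (2 : P.K) ≠ 0 := by
  have h := (map_ne_zero (algebraMap k P.K)).2 hk2
  rwa [map_ofNat] at h

lemma three_ne_zero_splitting (hk3 : (3 : k) ≠ 0) : (3 : P.K) ≠ 0 := by
  have h := (map_ne_zero (algebraMap k P.K)).2 hk3
  rwa [map_ofNat] at h

lemma algebraMap_traceForm (hk2 : (2 : k) ≠ 0) (hm : 0 < m) (x y : A) :
    algebraMap k P.K (A.traceForm x y) = 2 * m * tform P.C₁ P.C₂ (P.emb x) (P.emb y) := by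
  have := P.finite hm
  have h2 := P.two_ne_zero_splitting hk2
  rw [traceForm_apply, ← LinearMap.trace_baseChange, ← LinearMap.trace_conj' _ P.equiv]
  change LinearMap.trace _ _ (P.extend _) = _
  rw [extend_mulLeft, trace_mulLeft_tensor h2, P.finrank₁, P.finrank₂, emb_mul, emb_invol,
    tform_mul_right, tstar_tstar, one_mul, tform_comm]
  push_cast
  field_simp
  rw [tform_comm]
  ring

/-- A multiplication identity determines the `♮`-map up to a factor. -/
lemma exists_emb_natMap (hk2 : (2 : k) ≠ 0) (hk3 : (3 : k) ≠ 0) (Φ : AlbertForm A) :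
    ∃ μ : P.K, ∀ s : A.skew, P.emb (Φ.natMap s) = μ • tsharp P.C₁ P.C₂ (P.emb s) := by
  have h2 := P.two_ne_zero_splitting hk2
  have h3 := P.three_ne_zero_splitting hk3
  have h4 : (4 : P.K) ≠ 0 := by
    rw [show (4 : P.K) = 2 * 2 by norm_num]; exact mul_ne_zero h2 h2
  let pr : A.carrier →ₗ[k] A.skew := (LinearMap.id - A.invol).codRestrict A.skew fun a => by
    rw [mem_skew]; simp [A.invol_invol]
  have hpr : ∀ a, (pr a : A) = a - A.invol a := fun a => rfl
  let N := P.extend (A.skew.subtype ∘ₗ Φ.natMap ∘ₗ pr)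
  have hN : ∀ a, N (P.emb a) = P.emb (Φ.natMap (pr a)) := fun a => P.extend_emb _ a
  have hbil : ∀ y y', ∃ c : P.K, (y - tstar P.C₁ P.C₂ y) * N y' +
      (y' - tstar P.C₁ P.C₂ y') * N y = c • 1 := by
    intro y y'
    induction y using P.emb_induction with
    | ha x y hx hy =>
      obtain ⟨c, hc⟩ := hx
      obtain ⟨d, hd⟩ := hy
      refine ⟨c + d, ?_⟩
      rw [add_smul, ← hc, ← hd]
      simp only [map_add, add_mul, mul_add, sub_mul]
      abel
    | hs c a =>
      induction y' using P.emb_induction with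
      | ha x y hx hy =>
        obtain ⟨c, hc⟩ := hx
        obtain ⟨d, hd⟩ := hy
        refine ⟨c + d, ?_⟩
        rw [add_smul, ← hc, ← hd]
        simp only [map_add, add_mul, mul_add, sub_mul]
        abel
      | hs d b =>
        have key : (pr a : A) * Φ.natMap (pr b) + (pr b : A) * Φ.natMap (pr a) =
            -(QuadraticMap.polar Φ.Q (pr a) (pr b)) • (1 : A) := by
          have h := Φ.mul_natMap (pr a + pr b) 1
          have h' := Φ.mul_natMap (pr a) 1
          have hh := Φ.mul_natMap (pr b) 1
          simp only [mul_one, map_add, Submodule.coe_add, add_mul, mul_add] at h h' hh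
          rw [QuadraticMap.polar]
          linear_combination (norm := module) h - h' - hh
        have key' := congrArg P.emb key
        rw [emb_add, emb_mul, emb_mul, emb_smul, hpr, hpr, emb_sub, emb_sub, emb_invol, emb_invol,
          emb_one, ← hN, ← hN] at key'
        refine ⟨c * d * algebraMap k P.K (-(QuadraticMap.polar Φ.Q (pr a) (pr b))), ?_⟩
        rw [mul_smul, ← key']
        simp only [map_smul, ← smul_sub, smul_mul_assoc, mul_smul_comm]
        module
  let V : Submodule P.K (P.C₁.carrier ⊗[P.K] P.C₂.carrier) :=
    LinearMap.ker (tstar P.C₁ P.C₂ + LinearMap.id)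
  have hV : ∀ y : V, tstar P.C₁ P.C₂ y = -y := fun y => eq_neg_of_add_eq_zero_left y.2
  let Q₀ : QuadraticForm P.K V := (LinearMap.BilinMap.toQuadraticMap
    ((tform P.C₁ P.C₂).compl₂ (tsharp P.C₁ P.C₂))).comp V.subtype
  have hQ₀ : ∀ y : V, Q₀ y = tform P.C₁ P.C₂ y (tsharp P.C₁ P.C₂ y) := fun y => rfl
  obtain ⟨s, hs, hns⟩ := P.C₁.exists_skew_norm_ne_zero h2 P.finrank₁
  have hsV : s ⊗ₜ 1 ∈ V := by
    change tstar _ _ (s ⊗ₜ 1) + s ⊗ₜ 1 = 0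
    rw [tstar_tmul_one hs, neg_add_cancel]
  obtain ⟨μ, hμ⟩ := exists_smul_eq_of_anisotropic h2 h3 Q₀ ⟨s ⊗ₜ 1, hsV⟩ (by
      rw [hQ₀]
      have := tform_tsharp_self (t := (0 : P.C₂.carrier)) h2 hs (by simp)
      rw [TensorProduct.tmul_zero, add_zero, map_zero, sub_zero] at this
      rw [this]
      exact mul_ne_zero h4 hns)
    (tsharp P.C₁ P.C₂ ∘ₗ V.subtype) (N ∘ₗ V.subtype)
    (fun y y' h => Subtype.ext (by
      have := congrArg (tsharp P.C₁ P.C₂) h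
      simpa only [LinearMap.comp_apply, Submodule.subtype_apply, tsharp_tsharp] using this)) (by
      intro y hy
      rw [hQ₀] at hy
      obtain ⟨c, hc⟩ := hbil y y
      rw [hV, sub_neg_eq_add, ← two_smul P.K, ← two_smul P.K (y : P.C₁.carrier ⊗[P.K] P.C₂.carrier),
        smul_mul_assoc, smul_smul] at hc
      have h := tsharp_mul_mul h2 (hV y) (N y)
      rw [← mul_smul_comm, show (4 : P.K) = 2 * 2 by norm_num, hc,
        mul_smul_comm, mul_one] at h
      refine ⟨-(tform P.C₁ P.C₂ y (tsharp P.C₁ P.C₂ y))⁻¹ * c, ?_⟩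
      simp only [LinearMap.comp_apply, Submodule.subtype_apply]
      rw [mul_smul, h, smul_neg, neg_smul, neg_neg, smul_smul, inv_mul_cancel₀ hy, one_smul])
  refine ⟨2⁻¹ * μ, fun s => ?_⟩
  have hsV : P.emb s ∈ V := by
    change tstar _ _ (P.emb s) + P.emb s = 0
    rw [← emb_invol, invol_coe, emb_neg, neg_add_cancel]
  have h := hμ ⟨P.emb s, hsV⟩
  have hps : pr s = (2 : k) • s := Subtype.ext (by
    rw [hpr, invol_coe, sub_neg_eq_add, ← two_smul k]; rfl)
  simp only [LinearMap.comp_apply, Submodule.subtype_apply] at h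
  rw [hN, hps, map_smul, Submodule.coe_smul, emb_smul, map_ofNat] at h
  rw [mul_smul, ← h, smul_smul, inv_mul_cancel₀ h2, one_smul]

end ProductAlgebraSplitting

end AlbertData

section Regularity

universe u

open AlgebraWithInvolution CompositionAlgebra

namespace CompositionAlgebra

variable {F : Type u} [Field F] {C D : CompositionAlgebra F}

lemma tform_one_one : tform C D 1 1 = 4 := by
  rw [Algebra.TensorProduct.one_def, tform_tmul, C.bil_self, D.bil_self, C.norm_one, D.norm_one]
  norm_num

lemma tform_psi {u : C.carrier ⊗[F] D.carrier} (hu : tstar C D u = -u)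
    (x z : C.carrier ⊗[F] D.carrier) :
    tform C D u (x * tstar C D z - z * tstar C D x) = -2 * tform C D (u * x) z := by
  rw [map_sub, ← tform_mul_right, ← tform_mul_right, tform_mul_left u z, hu, neg_mul, map_neg,
    tform_comm z]
  ring

end CompositionAlgebra

namespace ProductAlgebraSplitting

variable {k : Type u} [Field k] {A : AlgebraWithInvolution k} {m : ℕ}
  (P : ProductAlgebraSplitting A 8 m)

lemma tstar_emb_skew (s : A.skew) : tstar P.C₁ P.C₂ (P.emb s) = -P.emb s := by
  rw [← emb_invol, invol_coe, emb_neg]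

lemma emb_psi (x z : A) : P.emb (A.psi x z) =
    P.emb x * tstar P.C₁ P.C₂ (P.emb z) - P.emb z * tstar P.C₁ P.C₂ (P.emb x) := by
  rw [psi, emb_sub, emb_mul, emb_mul, emb_invol, emb_invol]

lemma emb_Vop (x y z : A) :
    P.emb (A.Vop x y z) = tV (P.emb x) (P.emb y) (P.emb z) := by
  simp only [Vop, tV, emb_sub, emb_add, emb_mul, emb_invol]

lemma skew_induction (hk2 : (2 : k) ≠ 0) {p : P.C₁.carrier ⊗[P.K] P.C₂.carrier → Prop}
    (hs : ∀ (c : P.K) (s : A.skew), p (c • P.emb s)) (ha : ∀ x y, p x → p y → p (x + y)) {x}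
    (hx : tstar P.C₁ P.C₂ x = -x) : p x := by
  have h2 := P.two_ne_zero_splitting hk2
  have key : ∀ y, p (y - tstar P.C₁ P.C₂ y) := by
    intro y
    induction y using P.emb_induction with
    | hs c a =>
      have := hs c ⟨a - A.invol a, by rw [mem_skew, map_sub, A.invol_invol, neg_sub]⟩
      rwa [emb_sub, emb_invol, smul_sub, ← map_smul] at this
    | ha x y hx hy =>
      rw [map_add, add_sub_add_comm]
      exact ha _ _ hx hy
  have := key ((2 : P.K)⁻¹ • x)
  rwa [map_smul, hx, smul_neg, sub_neg_eq_add, ← smul_add, ← two_smul P.K, smul_smul,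
    inv_mul_cancel₀ h2, one_smul] at this

lemma three_le_finrank_skew (P : ProductAlgebraSplitting A 8 m) (hk2 : (2 : k) ≠ 0) (hm : 0 < m) :
    3 ≤ Module.finrank k A.skew := by
  have := P.finite hm
  have h2 := P.two_ne_zero_splitting hk2
  let f : P.K ⊗[k] A.skew →ₗ[P.K] P.C₁.carrier ⊗[P.K] P.C₂.carrier :=
    P.equiv.toLinearMap ∘ₗ A.skew.subtype.baseChange P.K
  let g : P.C₁.carrier →ₗ[P.K] P.C₁.carrier ⊗[P.K] P.C₂.carrier :=
    (TensorProduct.mk P.K P.C₁.carrier P.C₂.carrier).flip 1 ∘ₗ (LinearMap.id - P.C₁.conj)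
  have hg : ∀ c, g c = (c - P.C₁.conj c) ⊗ₜ 1 := fun c => rfl
  have hgf : LinearMap.range g ≤ LinearMap.range f := by
    rintro _ ⟨c, rfl⟩
    have hc : tstar P.C₁ P.C₂ (g c) = -g c := by
      rw [hg]
      exact tstar_tmul_one (by rw [map_sub, P.C₁.conj_conj, neg_sub])
    refine P.skew_induction hk2 (p := (· ∈ LinearMap.range f)) (fun d s => ?_)
      (fun x y hx hy => add_mem hx hy) hc
    refine ⟨d ⊗ₜ s, ?_⟩
    change P.equiv (d ⊗ₜ (s : A.carrier)) = _
    rw [emb, ← map_smul, TensorProduct.smul_tmul', smul_eq_mul, mul_one]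
  have hker : Module.finrank P.K (LinearMap.ker g) ≤ 1 := by
    refine finrank_le_one ⟨1, ?_⟩ fun t => ?_
    · rw [LinearMap.mem_ker, hg, P.C₁.conj_one, sub_self, TensorProduct.zero_tmul]
    · have ht : g t = 0 := t.2
      have hct : P.C₁.conj t = t := by
        refine (sub_eq_zero.1 (P.C₁.ext_bil (y := 0) fun y => ?_)).symm
        have h := congrArg (fun v => tform P.C₁ P.C₂ v (y ⊗ₜ 1)) ht
        simp only [hg, tform_tmul, P.C₂.bil_self, P.C₂.norm_one, map_zero, LinearMap.zero_apply,
          mul_one] at h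
        rw [map_zero, LinearMap.zero_apply]
        exact (mul_eq_zero.1 h).resolve_right h2
      exact ⟨2⁻¹ * P.C₁.bil t 1, Subtype.ext (P.C₁.eq_smul_one_of_conj_eq h2 hct).symm⟩
  have h1 := LinearMap.finrank_range_add_finrank_ker g
  rw [P.finrank₁] at h1
  have h3 := (Submodule.finrank_mono hgf).trans (LinearMap.finrank_range_le f)
  rw [Module.finrank_baseChange] at h3
  omega

lemma exists_albertForm_ne_zero (P : ProductAlgebraSplitting A 8 m) (hk2 : (2 : k) ≠ 0) (hm : 0 < m)
    (Φ : AlbertForm A) : ∃ s, Φ.Q s ≠ 0 := by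
  have := P.finite hm
  have h2 := P.two_ne_zero_splitting hk2
  have h4 : (4 : P.K) ≠ 0 := by
    rw [show (4 : P.K) = 2 * 2 by norm_num]; exact mul_ne_zero h2 h2
  have : ∃ s : A.skew, tform P.C₁ P.C₂ (P.emb s) (tsharp P.C₁ P.C₂ (P.emb s)) ≠ 0 := by
    by_contra! h
    have hst : ∀ s t : A.skew, tform P.C₁ P.C₂ (P.emb s) (tsharp P.C₁ P.C₂ (P.emb t)) = 0 := by
      intro s t
      have hst := h (s + t)
      rw [Submodule.coe_add, emb_add] at hst
      simp only [map_add, LinearMap.add_apply, h] at hst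
      rw [← tform_tsharp_left (P.emb t), tform_comm _ (P.emb s)] at hst
      refine (mul_eq_zero.1 ?_).resolve_left h2
      linear_combination hst
    have key : ∀ x, tstar P.C₁ P.C₂ x = -x → ∀ y, tstar P.C₁ P.C₂ y = -y →
        tform P.C₁ P.C₂ x (tsharp P.C₁ P.C₂ y) = 0 := by
      intro x hx y hy
      refine P.skew_induction hk2 (p := fun x => tform P.C₁ P.C₂ x (tsharp P.C₁ P.C₂ y) = 0)
        (fun c s => ?_) (fun x x' hx hx' => ?_) hx
      · refine P.skew_induction hk2
          (p := fun y => tform P.C₁ P.C₂ (c • P.emb s) (tsharp P.C₁ P.C₂ y) = 0)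
          (fun d t => ?_) (fun y y' hy hy' => ?_) hy
        · simp only [map_smul, LinearMap.smul_apply, hst, smul_zero]
        · simp only [map_add, hy, hy', add_zero]
      · simp only [map_add, LinearMap.add_apply, hx, hx', add_zero]
    obtain ⟨s, hs, hns⟩ := P.C₁.exists_skew_norm_ne_zero h2 P.finrank₁
    have h := tform_tsharp_self (t := (0 : P.C₂.carrier)) h2 hs (by simp)
    rw [TensorProduct.tmul_zero, add_zero, map_zero, sub_zero,
      key _ (tstar_tmul_one hs) _ (tstar_tmul_one hs)] at h
    exact mul_ne_zero h4 hns h.symm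
  obtain ⟨s, hs⟩ := this
  refine ⟨s, (Φ.nonzero_iff s).2 ?_⟩
  have hinj : Function.Injective (LinearMap.mulLeft k (s : A.carrier)) := by
    rw [← LinearMap.ker_eq_bot, LinearMap.ker_eq_bot']
    intro a ha
    have h := tsharp_mul_mul h2 (P.tstar_emb_skew s) (P.emb a)
    rw [LinearMap.mulLeft_apply] at ha
    rw [← emb_mul, ha, show P.emb 0 = 0 by simp [emb], mul_zero, smul_zero, zero_eq_neg,
      smul_eq_zero] at h
    exact P.emb_injective ((h.resolve_left hs).trans (by simp [emb]))
  exact ⟨hinj, LinearMap.injective_iff_surjective.1 hinj⟩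

section

variable {Φ : AlbertForm A} {μ : P.K}

lemma algebraMap_Q
    (hμ : ∀ s : A.skew, P.emb (Φ.natMap s) = μ • tsharp P.C₁ P.C₂ (P.emb s))
    (hk2 : (2 : k) ≠ 0) (s : A.skew) :
    4 * algebraMap k P.K (Φ.Q s) = μ * tform P.C₁ P.C₂ (P.emb s) (tsharp P.C₁ P.C₂ (P.emb s)) := by
  have h2 := P.two_ne_zero_splitting hk2
  have h := congrArg P.emb (Φ.mul_natMap s 1)
  rw [mul_one, emb_mul, hμ, emb_smul, emb_one, mul_smul_comm, map_neg] at h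
  have h' := mul_tsharp_mul h2 (P.tstar_emb_skew s) 1
  rw [mul_one] at h'
  have hh : (4 * algebraMap k P.K (Φ.Q s)) • (1 : P.C₁.carrier ⊗[P.K] P.C₂.carrier) =
      (μ * tform P.C₁ P.C₂ (P.emb s) (tsharp P.C₁ P.C₂ (P.emb s))) • 1 := by
    linear_combination (norm := module) (4 : P.K) • h - μ • h'
  have h1 := congrArg (fun v => tform P.C₁ P.C₂ v 1) hh
  simp only [map_smul, LinearMap.smul_apply, tform_one_one, smul_eq_mul] at h1
  refine mul_right_cancel₀ ?_ h1
  rw [show (4 : P.K) = 2 * 2 by norm_num]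
  exact mul_ne_zero h2 h2

lemma algebraMap_polar
    (hμ : ∀ s : A.skew, P.emb (Φ.natMap s) = μ • tsharp P.C₁ P.C₂ (P.emb s))
    (hk2 : (2 : k) ≠ 0) (s t : A.skew) :
    2 * algebraMap k P.K (QuadraticMap.polar Φ.Q s t) =
      μ * tform P.C₁ P.C₂ (P.emb s) (tsharp P.C₁ P.C₂ (P.emb t)) := by
  have h2 := P.two_ne_zero_splitting hk2
  have h := P.algebraMap_Q hμ hk2 (s + t)
  have hs := P.algebraMap_Q hμ hk2 s
  have ht := P.algebraMap_Q hμ hk2 t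
  rw [Submodule.coe_add, emb_add] at h
  simp only [map_add, LinearMap.add_apply] at h
  rw [← tform_tsharp_left (P.emb t), tform_comm _ (P.emb s)] at h
  rw [QuadraticMap.polar, map_sub, map_sub]
  refine mul_left_cancel₀ h2 ?_
  linear_combination h - hs - ht

end

theorem isRegular (P : ProductAlgebraSplitting A 8 m) (hk2 : (2 : k) ≠ 0) (hk3 : (3 : k) ≠ 0)
    (hm : (m : k) ≠ 0) (Φ : AlbertForm A) :
    Φ.IsRegular (8 * m) (-(2 * m)) := by
  have hm' : 0 < m := Nat.pos_of_ne_zero fun h => hm (by rw [h, Nat.cast_zero])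
  have h2 := P.two_ne_zero_splitting hk2
  have h3 := P.three_ne_zero_splitting hk3
  have hm2 : (2 * m : P.K) ≠ 0 :=
    mul_ne_zero h2 (by have := (map_ne_zero (algebraMap k P.K)).2 hm; rwa [map_natCast] at this)
  obtain ⟨μ, hμ⟩ := P.exists_emb_natMap hk2 hk3 Φ
  obtain ⟨s₀, hs₀⟩ := P.exists_albertForm_ne_zero hk2 hm' Φ
  have hQ := P.algebraMap_Q hμ hk2
  have hpolar := P.algebraMap_polar hμ hk2
  have h4 : (4 : P.K) ≠ 0 := by
    rw [show (4 : P.K) = 2 * 2 by norm_num]; exact mul_ne_zero h2 h2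
  have hμ0 : μ ≠ 0 := by
    rintro rfl
    have h := hQ s₀
    rw [zero_mul, mul_eq_zero] at h
    exact (map_ne_zero (algebraMap k P.K)).2 hs₀ (h.resolve_left h4)
  have inj := (algebraMap k P.K).injective
  have tr := P.algebraMap_traceForm hk2 hm'
  have hzero : P.emb 0 = 0 := by simp [emb]
  refine
    { finite := P.finite hm'
      finrank_eq := P.finrank_eq
      three_le_finrank_skew := P.three_le_finrank_skew hk2 hm'
      ne_zero := neg_ne_zero.2 (mul_ne_zero hk2 hm)
      form_comm := fun x y => inj (by rw [tr, tr, tform_comm])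
      form_nondegenerate := fun x hx => P.emb_injective ?_
      form_mul := fun x y z => inj (by rw [tr, tr, emb_mul, emb_mul, emb_invol, tform_mul_left])
      polar_nondegenerate := fun s hs => Subtype.ext (P.emb_injective ?_)
      natMap_injective := fun s t hst => Subtype.ext (P.emb_injective ?_)
      exists_ne_zero := ⟨s₀, hs₀⟩
      natMap_mul := fun s a => P.emb_injective ?_
      form_natMap := fun s x z => inj ?_
      Vop_skew_mul := fun s x y z => P.emb_injective ?_
      schur := fun T T' hT hT' hadj => ?_ }
  · rw [hzero]
    refine tform_nondegenerate h2 _ fun y => ?_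
    induction y using P.emb_induction with
    | hs c y =>
      have h := tr x y
      rw [hx, map_zero, zero_eq_mul] at h
      rw [map_smul, h.resolve_left hm2, smul_zero]
    | ha y y' hy hy' => rw [map_add, hy, hy', add_zero]
  · have h0 : ∀ y, tstar P.C₁ P.C₂ y = -y →
        tform P.C₁ P.C₂ (tsharp P.C₁ P.C₂ (P.emb s)) y = 0 := by
      intro y hy
      refine P.skew_induction hk2 (p := fun y =>
        tform P.C₁ P.C₂ (tsharp P.C₁ P.C₂ (P.emb s)) y = 0) (fun c t => ?_) (fun y y' hy hy' => ?_) hy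
      · have h := hpolar s t
        rw [hs, map_zero, mul_zero, zero_eq_mul, ← tform_tsharp_left] at h
        rw [map_smul, h.resolve_left hμ0, smul_zero]
      · rw [map_add, hy, hy', add_zero]
    have hsharp : tsharp P.C₁ P.C₂ (P.emb s) = 0 := by
      refine tform_nondegenerate h2 _ fun y => ?_
      have h := tform_sub_tstar (u := tsharp P.C₁ P.C₂ (P.emb s))
        (by rw [tstar_tsharp, tstar_emb_skew, map_neg]) y
      rw [h0 _ (by rw [map_sub, tstar_tstar, neg_sub]), zero_eq_mul] at h
      exact h.resolve_left h2
    rw [← tsharp_tsharp (P.emb s), hsharp, map_zero, Submodule.coe_zero, hzero]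
  · have h := congrArg (fun t : A.skew => P.emb t) hst
    simp only [hμ] at h
    rw [← tsharp_tsharp (P.emb s), smul_right_injective _ hμ0 h, tsharp_tsharp]
  · have h := tsharp_mul_mul h2 (P.tstar_emb_skew s) (P.emb a)
    rw [emb_mul, emb_mul, hμ, emb_smul, smul_mul_assoc, map_neg]
    refine smul_right_injective _ h4 ?_
    linear_combination (norm := module) μ • h + hQ s • P.emb a
  · have h := hpolar s (A.skewPsi x z)
    rw [← tform_tsharp_left, coe_skewPsi, emb_psi,
      tform_psi (by rw [tstar_tsharp, tstar_emb_skew, map_neg])] at h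
    rw [tr, emb_mul, hμ, smul_mul_assoc, map_smul, LinearMap.smul_apply, smul_eq_mul,
      map_mul (algebraMap k P.K), map_neg, map_mul (algebraMap k P.K), map_natCast, map_ofNat]
    linear_combination (m : P.K) * h
  · have h := tV_skew_mul h2 (P.tstar_emb_skew s) (P.emb x) (P.emb y) (P.emb z)
    rw [psi, A.invol_mul, invol_coe]
    simp only [emb_add, emb_mul, emb_neg, emb_sub, emb_Vop, emb_invol, h, mul_neg, sub_mul,
      neg_mul]
    abel
  · obtain ⟨l, hl⟩ := exists_eq_smul_of_intertwining h2 h3 P.finrank₁ (P.extend T) (P.extend T')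
      (fun s x hs => by
        refine P.skew_induction hk2 (p := fun s => s * P.extend T x = P.extend T' (s * x))
          (fun c s => ?_) (fun y y' hy hy' => ?_) hs
        · induction x using P.emb_induction with
          | hs d a => simp only [map_smul, smul_mul_assoc, mul_smul_comm, extend_emb, ← emb_mul, hT]
          | ha a a' ha ha' => simp only [map_add, mul_add, ha, ha']
        · simp only [add_mul, map_add, hy, hy'])
      (fun s x hs => by
        refine P.skew_induction hk2 (p := fun s => P.extend T (s * x) = s * P.extend T' x)
          (fun c s => ?_) (fun y y' hy hy' => ?_) hs
        · induction x using P.emb_induction with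
          | hs d a => simp only [map_smul, smul_mul_assoc, mul_smul_comm, extend_emb, ← emb_mul, hT']
          | ha a a' ha ha' => simp only [map_add, mul_add, ha, ha']
        · simp only [add_mul, map_add, hy, hy'])
      (fun x y => by
        induction x using P.emb_induction with
        | ha a a' ha ha' => simp only [map_add, LinearMap.add_apply, ha, ha']
        | hs d a =>
          induction y using P.emb_induction with
          | ha b b' hb hb' => simp only [map_add, hb, hb']
          | hs c b =>
            have h := congrArg (algebraMap k P.K) (hadj a b)
            rw [tr, tr] at h
            simp only [map_smul, LinearMap.smul_apply, extend_emb, mul_left_cancel₀ hm2 h])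
    have hTl : ∀ x, P.emb (T x) = l • P.emb x := fun x => by rw [← extend_emb, hl]
    refine ⟨(8 * m : k)⁻¹ * A.traceForm (T 1) 1, fun x => P.emb_injective ?_⟩
    rw [emb_smul, hTl, map_mul, tr, hTl, emb_one, map_smul, LinearMap.smul_apply, tform_one_one,
      map_inv₀, map_mul, map_natCast, map_ofNat, smul_eq_mul]
    congr 1
    have h8 : (8 * m : P.K) = 2 * m * 4 := by ring
    rw [h8]
    field_simp [right_ne_zero_of_mul hm2]

end ProductAlgebraSplitting

end Regularity

section SimilarityOfIsotopy

universe u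

namespace AlgebraWithInvolution

variable {k : Type u} [Field k] {A A' : AlgebraWithInvolution k}

lemma Vop_sub_Vop (x y z : A) : A.Vop x y z - A.Vop z y x = A.psi x z * y := by
  simp only [Vop, psi, sub_mul]
  abel

namespace Isotopy

/-- The inverse of an isotopy. -/
def symm (I : A.Isotopy A') : A'.Isotopy A where
  toLinearEquiv := I.toLinearEquiv.symm
  hat := I.hat.symm
  map_Vop x y z := by
    rw [LinearEquiv.symm_apply_eq, I.map_Vop]
    simp only [LinearEquiv.apply_symm_apply]

lemma map_psi_mul (I : A.Isotopy A') (x y z : A) : I.toLinearEquiv (A.psi x z * y) =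
    A'.psi (I.toLinearEquiv x) (I.toLinearEquiv z) * I.hat y := by
  rw [← Vop_sub_Vop, ← Vop_sub_Vop, map_sub, I.map_Vop, I.map_Vop]

/-- An isotopy induces a map on the skew elements. -/
lemma exists_skewMap (I : A.Isotopy A') (hk2 : (2 : k) ≠ 0) :
    ∃ σ : A.skew →ₗ[k] A'.skew, Function.Injective σ ∧
      ∀ (s : A.skew) (y : A), I.toLinearEquiv (s * y) = σ s * I.hat y := by
  let σ : A.skew →ₗ[k] A'.skew :=
    { toFun := fun s => (2 : k)⁻¹ • A'.skewPsi (I.toLinearEquiv s) (I.toLinearEquiv 1)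
      map_add' := fun s t => Subtype.ext (by
        simp only [Submodule.coe_add, Submodule.coe_smul, coe_skewPsi, psi, map_add, add_mul,
          mul_add]
        module)
      map_smul' := fun c s => Subtype.ext (by
        simp only [Submodule.coe_smul, coe_skewPsi, psi, map_smul, smul_mul_assoc, mul_smul_comm,
          RingHom.id_apply]
        module) }
  have hσ : ∀ (s : A.skew) (y : A), I.toLinearEquiv (s * y) = σ s * I.hat y := by
    intro s y
    have h := I.map_psi_mul s y 1
    rw [psi, A.invol_one, mul_one, one_mul, invol_coe, sub_neg_eq_add, ← two_smul k,
      smul_mul_assoc, map_smul] at h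
    change _ = ((2 : k)⁻¹ • A'.psi (I.toLinearEquiv s) (I.toLinearEquiv 1)) * _
    rw [smul_mul_assoc, ← h, smul_smul, inv_mul_cancel₀ hk2, one_smul]
  refine ⟨σ, ?_, hσ⟩
  rw [← LinearMap.ker_eq_bot, LinearMap.ker_eq_bot']
  intro s hs
  have h := hσ s 1
  rw [hs, Submodule.coe_zero, zero_mul, mul_one] at h
  exact Subtype.ext (by simpa using h)

end Isotopy

end AlgebraWithInvolution

open AlgebraWithInvolution

namespace AlbertForm

variable {k : Type u} [Field k] {A A' : AlgebraWithInvolution k} {Φ : AlbertForm A}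
  {Φ' : AlbertForm A'} {n : ℕ} {κ κ' : k}

lemma IsRegular.one_ne_zero (h : Φ.IsRegular n κ) : (1 : A) ≠ 0 := by
  intro h1
  obtain ⟨s, hs⟩ := h.exists_ne_zero
  refine hs ?_
  have : s = 0 := Subtype.ext (by
    rw [← mul_one (s : A.carrier), h1, mul_zero, Submodule.coe_zero])
  rw [this, QuadraticMap.map_zero]

/-- The Albert forms of isotopic algebras are similar. -/
theorem exists_isometryEquiv_of_isotopy (hk2 : (2 : k) ≠ 0) (hk3 : (3 : k) ≠ 0)
    (h : Φ.IsRegular n κ) (h' : Φ'.IsRegular n κ') (I : A.Isotopy A') :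
    ∃ c : kˣ, Nonempty (QuadraticMap.IsometryEquiv ((c : k) • Φ.Q) Φ'.Q) := by
  have := h.finite
  have := h'.finite
  obtain ⟨σ, hσ, hI⟩ := I.exists_skewMap hk2
  obtain ⟨σ', hσ', -⟩ := I.symm.exists_skewMap hk2
  have hdim : Module.finrank k A.skew = Module.finrank k A'.skew :=
    le_antisymm (LinearMap.finrank_le_finrank_of_injective hσ)
      (LinearMap.finrank_le_finrank_of_injective hσ')
  obtain ⟨s₀, hs₀⟩ := h.exists_ne_zero
  let f : A.skew →ₗ[k] A'.carrier →ₗ[k] A'.carrier :=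
    ((LinearMap.mul k A.carrier).domRestrict A.skew ∘ₗ Φ.natMap).compr₂ I.hat.toLinearMap |>.compl₂
      I.toLinearEquiv.symm.toLinearMap
  have hf : ∀ s x, f s (I.toLinearEquiv x) = I.hat (Φ.natMap s * x) := fun s x => by
    change I.hat (Φ.natMap s * I.toLinearEquiv.symm (I.toLinearEquiv x)) = _
    rw [LinearEquiv.symm_apply_apply]
  let g : A.skew →ₗ[k] A'.carrier →ₗ[k] A'.carrier :=
    (LinearMap.mul k A'.carrier).domRestrict A'.skew ∘ₗ Φ'.natMap ∘ₗ σ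
  have hg : ∀ s x, g s x = Φ'.natMap (σ s) * x := fun s x => rfl
  have hfs : ∀ s x, f s (I.toLinearEquiv (s * x)) = -(Φ.Q s) • I.hat x := fun s x => by
    rw [hf, h.natMap_mul, map_smul]
  have hgs : ∀ s x, g s (I.toLinearEquiv (s * x)) = -(Φ'.Q (σ s)) • I.hat x := fun s x => by
    rw [hg, hI, h'.natMap_mul]
  obtain ⟨μ, hμ⟩ := exists_smul_eq_of_anisotropic hk2 hk3 Φ.Q s₀ hs₀ f g
    (by
      rw [← LinearMap.ker_eq_bot, LinearMap.ker_eq_bot']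
      intro s hs
      have h1 := hf s 1
      rw [hs, LinearMap.zero_apply, mul_one] at h1
      have h2 : (Φ.natMap s : A.carrier) = 0 := I.hat.injective (by rw [← h1, map_zero])
      exact h.natMap_injective ((Subtype.ext h2).trans (map_zero _).symm))
    (by
      intro s hs
      refine ⟨Φ'.Q (σ s) * (Φ.Q s)⁻¹, LinearMap.ext fun x => ?_⟩
      obtain ⟨x, rfl⟩ := I.toLinearEquiv.surjective x
      obtain ⟨x, rfl⟩ := ((Φ.nonzero_iff s).1 hs).2 x
      rw [LinearMap.smul_apply, hfs, hgs, smul_smul]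
      congr 1
      field_simp)
  have hQ : ∀ s, Φ'.Q (σ s) = μ * Φ.Q s := by
    intro s
    have h1 := hgs s 1
    rw [hμ, LinearMap.smul_apply, hfs, smul_smul] at h1
    have h2 := smul_left_injective k ((map_ne_zero_iff _ I.hat.injective).2 h.one_ne_zero) h1
    linear_combination h2
  have hμ0 : μ ≠ 0 := by
    rintro rfl
    have h1 := (Φ.nonzero_iff s₀).1 hs₀
    refine (Φ'.nonzero_iff (σ s₀)).2 ?_ (by rw [hQ, zero_mul])
    have : (fun a : A'.carrier => (σ s₀ : A'.carrier) * a) =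
        I.toLinearEquiv ∘ (fun a : A.carrier => (s₀ : A.carrier) * a) ∘ I.hat.symm := by
      funext a
      simp only [Function.comp_apply, hI, LinearEquiv.apply_symm_apply]
    rw [this]
    exact I.toLinearEquiv.bijective.comp (h1.comp I.hat.symm.bijective)
  exact ⟨Units.mk0 μ hμ0, ⟨{ LinearEquiv.ofInjectiveOfFinrankEq σ hσ hdim with
    map_app' := fun s => hQ s }⟩⟩

end AlbertForm

end SimilarityOfIsotopy

section IsotopyOfSimilarity

universe u

open AlgebraWithInvolution

/-- The adjoint of linear maps with respect to a nondegenerate bilinear form on the source. -/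
lemma exists_adjoint {F V W : Type*} [Field F] [AddCommGroup V] [Module F V]
    [FiniteDimensional F V] [AddCommGroup W] [Module F W] (B : LinearMap.BilinForm F V)
    (hB : ∀ x, (∀ y, B x y = 0) → x = 0) (B' : LinearMap.BilinForm F W) :
    ∃ adj : (V →ₗ[F] W) →ₗ[F] W →ₗ[F] V, ∀ g y x, B (adj g y) x = B' y (g x) := by
  have hinj : Function.Injective B := by
    rw [← LinearMap.ker_eq_bot, LinearMap.ker_eq_bot']
    exact fun x hx => hB x fun y => by rw [hx, LinearMap.zero_apply]
  let D : V ≃ₗ[F] (V →ₗ[F] F) :=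
    LinearEquiv.ofInjectiveOfFinrankEq B hinj Subspace.dual_finrank_eq.symm
  have hD : ∀ φ x, B (D.symm φ) x = φ x := fun φ x =>
    DFunLike.congr_fun (D.apply_symm_apply φ) x
  refine ⟨{ toFun := fun g => D.symm.toLinearMap ∘ₗ g.dualMap ∘ₗ B'
            map_add' := fun g g' => LinearMap.ext fun y => D.injective ?_
            map_smul' := fun r g => LinearMap.ext fun y => D.injective ?_ }, fun g y x => hD _ _⟩
  · ext x
    simp
  · ext x
    simp

namespace AlbertForm

variable {k : Type u} [Field k] {A A' : AlgebraWithInvolution k} {Φ : AlbertForm A}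
  {Φ' : AlbertForm A'} {n : ℕ} {κ κ' c : k}

lemma mul_natMap_add (Φ : AlbertForm A) (s t : A.skew) (a : A) :
    (s : A) * (Φ.natMap t * a) + t * (Φ.natMap s * a) = -(QuadraticMap.polar Φ.Q s t) • a := by
  have h := Φ.mul_natMap (s + t) a
  simp only [map_add, Submodule.coe_add, add_mul, mul_add, Φ.mul_natMap] at h
  rw [QuadraticMap.polar]
  linear_combination (norm := module) h

namespace IsRegular

lemma natMap_mul_add (h : Φ.IsRegular n κ) (s t : A.skew) (a : A) :
    (Φ.natMap s : A) * (t * a) + Φ.natMap t * (s * a) =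
      -(QuadraticMap.polar Φ.Q s t) • a := by
  have h1 := h.natMap_mul (s + t) a
  simp only [map_add, Submodule.coe_add, add_mul, mul_add, h.natMap_mul] at h1
  rw [QuadraticMap.polar]
  linear_combination (norm := module) h1

lemma form_skew_mul (h : Φ.IsRegular n κ) (s : A.skew) (x y : A) :
    A.traceForm (s * x) y = -A.traceForm x (s * y) := by
  rw [h.form_mul, invol_coe, neg_mul, map_neg]

lemma natMap_surjective (h : Φ.IsRegular n κ) : Function.Surjective Φ.natMap := by
  have := h.finite
  exact LinearMap.injective_iff_surjective.1 h.natMap_injective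

lemma exists_orthogonal_triple (hk2 : (2 : k) ≠ 0) (h : Φ.IsRegular n κ) :
    ∃ s t v : A.skew, Φ.Q s ≠ 0 ∧ Φ.Q t ≠ 0 ∧ Φ.Q v ≠ 0 ∧ QuadraticMap.polar Φ.Q s t = 0 ∧
      QuadraticMap.polar Φ.Q s v = 0 ∧ QuadraticMap.polar Φ.Q t v = 0 := by
  have := h.finite
  obtain ⟨e, he, hQ⟩ := exists_anisotropic_orthogonal_basis hk2 Φ.Q h.polar_nondegenerate
  have h3 := h.three_le_finrank_skew
  exact ⟨e ⟨0, by omega⟩, e ⟨1, by omega⟩, e ⟨2, by omega⟩, hQ _, hQ _, hQ _,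
    he _ _ (by simp), he _ _ (by simp), he _ _ (by simp)⟩

/-- A pair of maps intertwining the left multiplications by skew elements gives an isotopy. -/
lemma isIsotopic_of_intertwining (hk2 : (2 : k) ≠ 0) (h : Φ.IsRegular n κ)
    (h' : Φ'.IsRegular n κ') (hc : c ≠ 0) {d : k} (hd : d ≠ 0) (α β : A.carrier ≃ₗ[k] A'.carrier)
    (σ : A.skew →ₗ[k] A'.skew) (hα : ∀ (s : A.skew) (x : A), α (s * x) = σ s * β x)
    (hQ : ∀ s, Φ'.Q (σ s) = c * Φ.Q s)
    (hψ : ∀ x z : A, A'.skewPsi (α x) (α z) = d • σ (A.skewPsi x z)) : A.IsIsotopic A' := by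
  let E : A → A → A → A' := fun x y z => A'.Vop (α x) (d⁻¹ • β y) (α z) - α (A.Vop x y z)
  let G : A → A → A → A' := fun x y z => A'.Vop (d⁻¹ • β y) (α x) (β z) - β (A.Vop y x z)
  have hψ' : ∀ (x z w : A), d⁻¹ • (A'.psi (α x) (α z) * β w) = α (A.psi x z * w) := by
    intro x z w
    have h1 := congrArg (fun s : A'.skew => (s : A')) (hψ x z)
    simp only [coe_skewPsi, Submodule.coe_smul] at h1
    rw [h1, smul_mul_assoc, ← hα, coe_skewPsi, smul_smul, inv_mul_cancel₀ hd, one_smul]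
  have hE_symm : ∀ x y z, E x y z = E z y x := by
    intro x y z
    have h1 := Vop_sub_Vop (A := A') (α x) (d⁻¹ • β y) (α z)
    have h2 := congrArg α (Vop_sub_Vop (A := A) x y z)
    rw [mul_smul_comm, hψ'] at h1
    rw [map_sub] at h2
    change A'.Vop (α x) (d⁻¹ • β y) (α z) - α (A.Vop x y z) =
      A'.Vop (α z) (d⁻¹ • β y) (α x) - α (A.Vop z y x)
    linear_combination (norm := abel) h1 - h2
  have hE_mul : ∀ (s : A.skew) x y z, E x y (s * z) = -(σ s * G x y z) := by
    intro s x y z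
    have h1 := h'.Vop_skew_mul (σ s) (α x) (d⁻¹ • β y) (β z)
    have h2 := congrArg α (h.Vop_skew_mul s x y z)
    rw [mul_smul_comm, ← hα, ← hα] at h1
    rw [map_add, map_neg, hα s (A.Vop y x z), ← hψ'] at h2
    have h3 : A'.psi (α x) (d⁻¹ • α (s * y)) = d⁻¹ • A'.psi (α x) (α (s * y)) := by
      simp only [psi, map_smul, mul_smul_comm, smul_mul_assoc, smul_sub]
    rw [h3, smul_mul_assoc] at h1
    change A'.Vop (α x) (d⁻¹ • β y) (α (s * z)) - α (A.Vop x y (s * z)) =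
      -(σ s * (A'.Vop (d⁻¹ • β y) (α x) (β z) - β (A.Vop y x z)))
    rw [mul_sub]
    linear_combination (norm := abel) h1 - h2
  have hG : ∀ (t : A.skew) x y z, Φ.Q t ≠ 0 →
      c • G x y (Φ.natMap t * z) = -(Φ'.natMap (σ t) * E x y z) := by
    intro t x y z ht
    have h1 := hE_mul t x y (Φ.natMap t * z)
    have h2 : E x y (-(Φ.Q t) • z) = -(Φ.Q t) • E x y z := by
      simp only [E, Vop, map_smul, mul_smul_comm, smul_mul_assoc, map_sub, map_add]
      module
    rw [Φ.mul_natMap, h2] at h1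
    have h3 := congrArg (fun v => (Φ'.natMap (σ t) : A') * v) h1
    simp only [mul_smul_comm, mul_neg, h'.natMap_mul, hQ] at h3
    refine smul_right_injective _ ht ?_
    linear_combination (norm := module) (-1 : k) • h3
  have hE_mul_mul : ∀ (s t : A.skew) x y z, Φ.Q t ≠ 0 →
      c • E x y (s * (Φ.natMap t * z)) = σ s * (Φ'.natMap (σ t) * E x y z) := by
    intro s t x y z ht
    rw [hE_mul, smul_neg, ← mul_smul_comm, hG t x y z ht, mul_neg, neg_neg]
  obtain ⟨s, t, v, hs, ht, hv, hst, hsv, htv⟩ := h.exists_orthogonal_triple hk2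
  have hpolar : ∀ s t, QuadraticMap.polar Φ'.Q (σ s) (σ t) = c * QuadraticMap.polar Φ.Q s t := by
    intro s t
    rw [QuadraticMap.polar, ← map_add, hQ, hQ, hQ, QuadraticMap.polar]
    ring
  have hE_zero : ∀ x y z, E x y z = 0 := by
    intro x y z
    have e1 : (c * c) • E (s * (Φ.natMap t * x)) y (s * (Φ.natMap v * z)) =
        σ s * (Φ'.natMap (σ v) * (σ s * (Φ'.natMap (σ t) * E x y z))) := by
      rw [mul_smul, hE_mul_mul _ _ _ _ _ hv, hE_symm, ← mul_smul_comm, ← mul_smul_comm,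
        hE_mul_mul _ _ _ _ _ ht, hE_symm]
    have e2 : (c * c) • E (s * (Φ.natMap t * x)) y (s * (Φ.natMap v * z)) =
        σ s * (Φ'.natMap (σ t) * (σ s * (Φ'.natMap (σ v) * E x y z))) := by
      rw [hE_symm, mul_smul, hE_mul_mul _ _ _ _ _ ht, hE_symm, ← mul_smul_comm, ← mul_smul_comm,
        hE_mul_mul _ _ _ _ _ hv]
    have swap : ∀ t a, QuadraticMap.polar Φ.Q s t = 0 →
        (σ s : A') * (Φ'.natMap (σ t) * (σ s * a)) = (c * Φ.Q s) • (σ t * a) := by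
      intro t a hst
      have h1 := h'.natMap_mul_add (σ s) (σ t) a
      rw [hpolar, hst, mul_zero, neg_zero, zero_smul] at h1
      rw [← hQ, eq_neg_of_add_eq_zero_right h1, mul_neg, Φ'.mul_natMap]
      module
    rw [swap v _ hsv] at e1
    rw [swap t _ hst] at e2
    have h1 := Φ'.mul_natMap_add (σ t) (σ v) (E x y z)
    rw [hpolar, htv, mul_zero, neg_zero, zero_smul] at h1
    have h2 : (2 * (c * Φ.Q s)) • ((σ v : A') * (Φ'.natMap (σ t) * E x y z)) = 0 := by
      linear_combination (norm := module) (c * Φ.Q s) • h1 - e1 + e2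
    have h3 := (smul_eq_zero.1 h2).resolve_left (mul_ne_zero hk2 (mul_ne_zero hc hs))
    have h4 := h'.natMap_mul (σ v) (Φ'.natMap (σ t) * E x y z)
    rw [h3, mul_zero, hQ] at h4
    replace h4 := (smul_eq_zero.1 h4.symm).resolve_left (neg_ne_zero.2 (mul_ne_zero hc hv))
    have h5 := Φ'.mul_natMap (σ t) (E x y z)
    rw [h4, mul_zero, hQ] at h5
    exact (smul_eq_zero.1 h5.symm).resolve_left (neg_ne_zero.2 (mul_ne_zero hc ht))
  exact ⟨{ toLinearEquiv := α
           hat := β.trans (LinearEquiv.smulOfNeZero k A'.carrier d⁻¹ (inv_ne_zero hd))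
           map_Vop := fun x y z => (sub_eq_zero.1 (hE_zero x y z)).symm }⟩

end IsRegular

end AlbertForm

end IsotopyOfSimilarity

section IntertwiningOfSimilarity

universe u

open AlgebraWithInvolution

namespace AlbertForm

namespace IsRegular

variable {k : Type u} [Field k] {A A' : AlgebraWithInvolution k} {Φ : AlbertForm A}
  {Φ' : AlbertForm A'} {n : ℕ} {κ κ' c : k}

/-- Similar Albert forms give a pair of maps intertwining the left multiplications by skew
elements. -/
lemma exists_intertwining (hk2 : (2 : k) ≠ 0) (h : Φ.IsRegular n κ) (h' : Φ'.IsRegular n κ')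
    (hn : (n : k) ≠ 0) (hc : c ≠ 0) (σ : A.skew →ₗ[k] A'.skew)
    (hQ : ∀ s, Φ'.Q (σ s) = c * Φ.Q s)
    (adj : (A.carrier →ₗ[k] A'.carrier) →ₗ[k] A'.carrier →ₗ[k] A.carrier)
    (hadj : ∀ g y x, A.traceForm (adj g y) x = A'.traceForm y (g x)) :
    ∃ (α β : A.carrier →ₗ[k] A'.carrier) (σ : A.skew →ₗ[k] A'.skew),
      (∀ (s : A.skew) (x : A), α (s * x) = σ s * β x) ∧
      (∀ (s : A.skew) (x : A), c • β (Φ.natMap s * x) = Φ'.natMap (σ s) * α x) ∧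
      LinearMap.trace k _ (adj α ∘ₗ β) + LinearMap.trace k _ (adj β ∘ₗ α) ≠ 0 := by
  have := h.finite
  have := h'.finite
  have hpolar : ∀ s t, QuadraticMap.polar Φ'.Q (σ s) (σ t) = c * QuadraticMap.polar Φ.Q s t := by
    intro s t
    rw [QuadraticMap.polar, ← map_add, hQ, hQ, hQ, QuadraticMap.polar]
    ring
  obtain ⟨e, he, hQe⟩ := exists_anisotropic_orthogonal_basis hk2 Φ.Q h.polar_nondegenerate
  let L : A.skew → A.carrier →ₗ[k] A.carrier := fun s => LinearMap.mulLeft k (s : A)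
  let L' : A'.skew → A'.carrier →ₗ[k] A'.carrier := fun s => LinearMap.mulLeft k (s : A')
  let inv : A.skew → (A.carrier →ₗ[k] A'.carrier) × (A.carrier →ₗ[k] A'.carrier) →ₗ[k]
      (A.carrier →ₗ[k] A'.carrier) × (A.carrier →ₗ[k] A'.carrier) := fun s =>
    { toFun := fun v => (-(Φ.Q s)⁻¹ • (L' (σ s) ∘ₗ v.2 ∘ₗ L (Φ.natMap s)),
        -(c * Φ.Q s)⁻¹ • (L' (Φ'.natMap (σ s)) ∘ₗ v.1 ∘ₗ L s))
      map_add' := fun v w => by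
        simp only [Prod.fst_add, Prod.snd_add, LinearMap.add_comp, LinearMap.comp_add, smul_add,
          Prod.mk_add_mk]
      map_smul' := fun r v => by
        simp only [Prod.smul_fst, Prod.smul_snd, LinearMap.smul_comp, LinearMap.comp_smul,
          RingHom.id_apply, Prod.smul_mk, smul_comm r] }
  have inv_fst : ∀ s v x, (inv s v).1 x = -(Φ.Q s)⁻¹ • (σ s * v.2 (Φ.natMap s * x)) :=
    fun s v x => rfl
  have inv_snd : ∀ s v x, (inv s v).2 x = -(c * Φ.Q s)⁻¹ • (Φ'.natMap (σ s) * v.1 (s * x)) :=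
    fun s v x => rfl
  let b : LinearMap.BilinForm k
      ((A.carrier →ₗ[k] A'.carrier) × (A.carrier →ₗ[k] A'.carrier)) := LinearMap.mk₂ k
    (fun v w => LinearMap.trace k _ (adj v.1 ∘ₗ w.2) + LinearMap.trace k _ (adj v.2 ∘ₗ w.1))
    (fun v v' w => by
      simp only [Prod.fst_add, Prod.snd_add, map_add, LinearMap.add_comp]; ring)
    (fun r v w => by
      simp only [Prod.smul_fst, Prod.smul_snd, map_smul, LinearMap.smul_comp, smul_add])
    (fun v w w' => by
      simp only [Prod.fst_add, Prod.snd_add, map_add, LinearMap.comp_add]; ring)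
    (fun r v w => by
      simp only [Prod.smul_fst, Prod.smul_snd, map_smul, LinearMap.comp_smul, smul_add])
  have hb : ∀ v w, b v w =
      LinearMap.trace k _ (adj v.1 ∘ₗ w.2) + LinearMap.trace k _ (adj v.2 ∘ₗ w.1) :=
    fun v w => rfl
  have adj_comp : ∀ (s' : A'.skew) (s : A.skew) (f : A.carrier →ₗ[k] A'.carrier),
      adj (L' s' ∘ₗ f ∘ₗ L s) = L s ∘ₗ adj f ∘ₗ L' s' := by
    intro s' s f
    refine LinearMap.ext fun y => sub_eq_zero.1 (h.form_nondegenerate _ fun x => ?_)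
    rw [map_sub, LinearMap.sub_apply, hadj, sub_eq_zero]
    change A'.traceForm y (s' * f (s * x)) = A.traceForm (s * adj f (s' * y)) x
    rw [h.form_skew_mul, hadj, h'.form_skew_mul, neg_neg]
  have trace_eq : ∀ (s' t' : A'.skew) (s t : A.skew) (f g : A.carrier →ₗ[k] A'.carrier) (p q : k),
      (∀ y, (s' : A') * (t' * y) = p • y) → (∀ x, (s : A) * (t * x) = q • x) →
      LinearMap.trace k _ ((L t ∘ₗ adj f ∘ₗ L' s') ∘ₗ (L' t' ∘ₗ g ∘ₗ L s)) =
        p * q * LinearMap.trace k _ (adj f ∘ₗ g) := by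
    intro s' t' s t f g p q hp hq
    have h1 : (L t ∘ₗ adj f ∘ₗ L' s') ∘ₗ (L' t' ∘ₗ g ∘ₗ L s) =
        L t ∘ₗ (p • (adj f ∘ₗ g) ∘ₗ L s) := by
      refine LinearMap.ext fun x => ?_
      change (t : A) * adj f (s' * (t' * g (s * x))) = t * (p • adj f (g (s * x)))
      rw [hp, map_smul]
    have h2 : (p • (adj f ∘ₗ g) ∘ₗ L s) ∘ₗ L t = (p * q) • (adj f ∘ₗ g) := by
      refine LinearMap.ext fun x => ?_
      change p • adj f (g (s * (t * x))) = (p * q) • adj f (g x)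
      rw [hq, map_smul, map_smul, smul_smul]
    rw [h1, LinearMap.trace_comp_comm', h2, map_smul, smul_eq_mul]
  obtain ⟨adj', hadj'⟩ := exists_adjoint A'.traceForm h'.form_nondegenerate A.traceForm
  let φ : A.carrier ≃ₗ[k] A'.carrier :=
    LinearEquiv.ofFinrankEq _ _ (h.finrank_eq.trans h'.finrank_eq.symm)
  have hφ₁ : adj (adj' φ.symm.toLinearMap) ∘ₗ φ.toLinearMap = LinearMap.id := by
    refine LinearMap.ext fun x => sub_eq_zero.1 (h.form_nondegenerate _ fun y => ?_)
    rw [map_sub, LinearMap.sub_apply, LinearMap.comp_apply, hadj, h'.form_comm, hadj', h.form_comm]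
    simp
  have hφ₂ : adj φ.toLinearMap ∘ₗ adj' φ.symm.toLinearMap = LinearMap.id := by
    refine LinearMap.ext fun x => sub_eq_zero.1 (h.form_nondegenerate _ fun y => ?_)
    rw [map_sub, LinearMap.sub_apply, LinearMap.comp_apply, hadj, hadj']
    simp
  have hv₀ : b (adj' φ.symm.toLinearMap, φ.toLinearMap) (adj' φ.symm.toLinearMap, φ.toLinearMap)
      ≠ 0 := by
    rw [hb, hφ₁, hφ₂, LinearMap.trace_id, h.finrank_eq, ← two_mul]
    exact mul_ne_zero hk2 hn
  obtain ⟨ε, v, hε, hv, hinv⟩ := exists_common_eigenvector hk2 b (fun i => inv (e i))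
    (by
      intro i v
      have hi := hQe i
      refine Prod.ext (LinearMap.ext fun x => ?_) (LinearMap.ext fun x => ?_)
      · rw [inv_fst, inv_snd, Φ.mul_natMap, mul_smul_comm, Φ'.mul_natMap, hQ, map_smul, smul_smul,
          smul_smul, smul_smul]
        convert one_smul k _ using 2
        field_simp
      · rw [inv_snd, inv_fst, h.natMap_mul, mul_smul_comm, h'.natMap_mul, hQ, map_smul, smul_smul,
          smul_smul, smul_smul]
        convert one_smul k _ using 2
        field_simp)
    (by
      intro i j hij v
      have hσ := hpolar (e i) (e j)
      rw [he i j hij, mul_zero] at hσ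
      have h1 := fun a => Φ.mul_natMap_add (e i) (e j) a
      have h2 := fun a => h.natMap_mul_add (e i) (e j) a
      have h1' := fun a => Φ'.mul_natMap_add (σ (e i)) (σ (e j)) a
      have h2' := fun a => h'.natMap_mul_add (σ (e i)) (σ (e j)) a
      simp only [he i j hij, neg_zero, zero_smul, add_eq_zero_iff_eq_neg] at h1 h2
      simp only [hσ, neg_zero, zero_smul, add_eq_zero_iff_eq_neg] at h1' h2'
      refine Prod.ext (LinearMap.ext fun x => ?_) (LinearMap.ext fun x => ?_)
      · rw [inv_fst, inv_snd, inv_fst, inv_snd, h1, map_neg, mul_smul_comm, mul_smul_comm, mul_neg,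
          mul_neg, h1', smul_smul, smul_smul]
        congr 1
        rw [mul_inv, mul_inv]
        ring
      · rw [inv_snd, inv_fst, inv_snd, inv_fst, h2, map_neg, mul_smul_comm, mul_smul_comm, mul_neg,
          mul_neg, h2', smul_smul, smul_smul]
        congr 1
        rw [mul_inv, mul_inv]
        ring)
    (by
      intro i v w
      have hi := hQe i
      have t1 := trace_eq (σ (e i)) (Φ'.natMap (σ (e i))) (e i) (Φ.natMap (e i)) v.2 w.1 _ _
        (fun y => Φ'.mul_natMap _ y) (fun x => Φ.mul_natMap _ x)
      have t2 := trace_eq (Φ'.natMap (σ (e i))) (σ (e i)) (Φ.natMap (e i)) (e i) v.1 w.2 _ _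
        (fun y => h'.natMap_mul _ y) (fun x => h.natMap_mul _ x)
      rw [hb, hb]
      change LinearMap.trace k _ (adj (-(Φ.Q (e i))⁻¹ • (L' _ ∘ₗ v.2 ∘ₗ L _)) ∘ₗ
          (-(c * Φ.Q (e i))⁻¹ • (L' _ ∘ₗ w.1 ∘ₗ L _))) +
        LinearMap.trace k _ (adj (-(c * Φ.Q (e i))⁻¹ • (L' _ ∘ₗ v.1 ∘ₗ L _)) ∘ₗ
          (-(Φ.Q (e i))⁻¹ • (L' _ ∘ₗ w.2 ∘ₗ L _))) = _
      rw [map_smul, map_smul, adj_comp, adj_comp, LinearMap.smul_comp, LinearMap.smul_comp,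
        LinearMap.comp_smul, LinearMap.comp_smul, map_smul, map_smul, map_smul, map_smul, t1, t2,
        hQ]
      simp only [smul_eq_mul]
      field_simp
      ring) _ hv₀
  have h1 : ∀ i x, v.1 (e i * x) = ε i • (σ (e i) * v.2 x) := by
    intro i x
    have hi := hQe i
    have h1 := DFunLike.congr_fun (congrArg Prod.fst (hinv i)) ((e i : A) * x)
    rw [inv_fst, h.natMap_mul, map_smul, mul_smul_comm, smul_smul, neg_mul_neg,
      inv_mul_cancel₀ hi, one_smul] at h1
    rw [h1, Prod.smul_fst, LinearMap.smul_apply, smul_smul, hε, one_smul]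
  have h2 : ∀ i x, c • v.2 (Φ.natMap (e i) * x) = ε i • (Φ'.natMap (σ (e i)) * v.1 x) := by
    intro i x
    have hi := hQe i
    have h1 := DFunLike.congr_fun (congrArg Prod.snd (hinv i)) ((Φ.natMap (e i) : A) * x)
    rw [inv_snd, Φ.mul_natMap, map_smul, mul_smul_comm, smul_smul, neg_mul_neg, mul_inv,
      inv_mul_cancel_right₀ hi] at h1
    have h3 : (Φ'.natMap (σ (e i)) : A') * v.1 x = c • ε i • v.2 (Φ.natMap (e i) * x) := by
      rw [inv_smul_eq_iff₀ hc] at h1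
      exact h1
    rw [h3, smul_comm, smul_smul (ε i), hε, one_smul]
  refine ⟨v.1, v.2, e.constr k fun i => ε i • σ (e i), fun s x => ?_, fun s x => ?_, hv⟩
  · induction (e.span_eq ▸ Submodule.mem_top : s ∈ Submodule.span k (Set.range e)) using
      Submodule.span_induction with
    | mem s hs =>
      obtain ⟨i, rfl⟩ := hs
      rw [e.constr_basis, Submodule.coe_smul, smul_mul_assoc, h1]
    | zero => simp
    | add s t _ _ hs ht => simp only [Submodule.coe_add, add_mul, map_add, hs, ht]
    | smul r s _ hs => simp only [Submodule.coe_smul, smul_mul_assoc, map_smul, hs]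
  · induction (e.span_eq ▸ Submodule.mem_top : s ∈ Submodule.span k (Set.range e)) using
      Submodule.span_induction with
    | mem s hs =>
      obtain ⟨i, rfl⟩ := hs
      rw [e.constr_basis, map_smul, Submodule.coe_smul, smul_mul_assoc, h2]
    | zero => simp
    | add s t _ _ hs ht => simp only [Submodule.coe_add, add_mul, map_add, smul_add, hs, ht]
    | smul r s _ hs => simp only [Submodule.coe_smul, smul_mul_assoc, map_smul, smul_comm c, hs]

/-- Algebras with similar Albert forms are isotopic. -/
theorem isIsotopic (hk2 : (2 : k) ≠ 0) (h : Φ.IsRegular n κ) (h' : Φ'.IsRegular n κ')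
    (hn : (n : k) ≠ 0) (hc : c ≠ 0) (τ : A.skew ≃ₗ[k] A'.skew)
    (hτ : ∀ s, Φ'.Q (τ s) = c * Φ.Q s) : A.IsIsotopic A' := by
  have := h.finite
  have := h'.finite
  obtain ⟨adj, hadj⟩ := exists_adjoint A.traceForm h.form_nondegenerate A'.traceForm
  obtain ⟨α, β, σ, hα, hβ, htr⟩ :=
    exists_intertwining hk2 h h' hn hc τ.toLinearMap hτ adj hadj
  have hadj' : ∀ x y, A.traceForm ((adj α ∘ₗ β) x) y = A.traceForm x ((adj β ∘ₗ α) y) := by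
    intro x y
    rw [h.form_comm x, LinearMap.comp_apply, LinearMap.comp_apply, hadj, hadj, h'.form_comm]
  have hT : ∀ (s : A.skew) (x : A), s * (adj α ∘ₗ β) x = (adj β ∘ₗ α) (s * x) := by
    intro s x
    refine sub_eq_zero.1 (h.form_nondegenerate _ fun y => ?_)
    rw [map_sub, LinearMap.sub_apply, sub_eq_zero, h.form_skew_mul, LinearMap.comp_apply,
      LinearMap.comp_apply, hadj, hadj, hα, hα, h'.form_skew_mul]
  have hT' : ∀ (s : A.skew) (x : A), (adj α ∘ₗ β) (s * x) = s * (adj β ∘ₗ α) x := by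
    intro s x
    obtain ⟨s, rfl⟩ := h.natMap_surjective s
    refine sub_eq_zero.1 (h.form_nondegenerate _ fun y => smul_right_injective _ hc ?_)
    rw [map_sub, LinearMap.sub_apply, h.form_skew_mul, LinearMap.comp_apply,
      LinearMap.comp_apply, hadj, hadj]
    simp only [smul_sub, smul_neg, smul_zero]
    rw [← LinearMap.smul_apply, ← map_smul, hβ, ← map_smul, hβ, h'.form_skew_mul]
    ring
  obtain ⟨l, hl⟩ := h.schur _ _ hT hT' hadj'
  have hl' : ∀ x, (adj β ∘ₗ α) x = l • x := by
    intro x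
    refine sub_eq_zero.1 (h.form_nondegenerate _ fun y => ?_)
    rw [map_sub, LinearMap.sub_apply, h.form_comm, ← hadj', hl, map_smul, LinearMap.smul_apply,
      map_smul, LinearMap.smul_apply, h.form_comm, sub_self]
  have hl0 : l ≠ 0 := by
    rintro rfl
    refine htr ?_
    rw [show adj α ∘ₗ β = 0 from LinearMap.ext fun x => by rw [hl, zero_smul]; rfl,
      show adj β ∘ₗ α = 0 from LinearMap.ext fun x => by rw [hl', zero_smul]; rfl, map_zero,
      add_zero]
  have hform : ∀ x y, A'.traceForm (β x) (α y) = l * A.traceForm x y := by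
    intro x y
    have h1 := hl x
    rw [LinearMap.comp_apply] at h1
    rw [← hadj, h1, map_smul, LinearMap.smul_apply, smul_eq_mul]
  have hα_inj : Function.Injective α := by
    rw [← LinearMap.ker_eq_bot, LinearMap.ker_eq_bot']
    intro x hx
    have h1 := hl' x
    rw [LinearMap.comp_apply, hx, map_zero] at h1
    exact (smul_eq_zero.1 h1.symm).resolve_left hl0
  have hβ_inj : Function.Injective β := by
    rw [← LinearMap.ker_eq_bot, LinearMap.ker_eq_bot']
    intro x hx
    have h1 := hl x
    rw [LinearMap.comp_apply, hx, map_zero] at h1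
    exact (smul_eq_zero.1 h1.symm).resolve_left hl0
  have hQ : ∀ s, Φ'.Q (σ s) = c * Φ.Q s := by
    intro s
    have h1 := hβ s (s * 1)
    rw [hα, h'.natMap_mul, h.natMap_mul, map_smul, smul_smul] at h1
    have h2 := smul_left_injective k ((map_ne_zero_iff _ hβ_inj).2 h.one_ne_zero) h1
    linear_combination h2
  have hpolar : ∀ s t, QuadraticMap.polar Φ'.Q (σ s) (σ t) = c * QuadraticMap.polar Φ.Q s t := by
    intro s t
    rw [QuadraticMap.polar, ← map_add, hQ, hQ, hQ, QuadraticMap.polar]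
    ring
  have hσ : Function.Surjective σ := by
    refine (LinearMap.injective_iff_surjective_of_finrank_eq_finrank τ.finrank_eq).1 ?_
    rw [← LinearMap.ker_eq_bot, LinearMap.ker_eq_bot']
    intro s hs
    have h1 := hα s 1
    rw [hs, Submodule.coe_zero, zero_mul, mul_one] at h1
    exact Subtype.ext (hα_inj (h1.trans (map_zero α).symm))
  have hdim := h.finrank_eq.trans h'.finrank_eq.symm
  refine isIsotopic_of_intertwining hk2 h h' hc
    (div_ne_zero (mul_ne_zero hl0 h.ne_zero) h'.ne_zero)
    (LinearEquiv.ofInjectiveOfFinrankEq α hα_inj hdim)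
    (LinearEquiv.ofInjectiveOfFinrankEq β hβ_inj hdim) σ hα hQ fun x z => ?_
  change A'.skewPsi (α x) (α z) = (l * κ / κ') • σ (A.skewPsi x z)
  refine sub_eq_zero.1 (h'.polar_nondegenerate _ fun t => ?_)
  obtain ⟨s, rfl⟩ := hσ t
  have h1 := h'.form_natMap (σ s) (α x) (α z)
  rw [← hβ, map_smul, LinearMap.smul_apply, hform, h.form_natMap, smul_eq_mul] at h1
  rw [sub_eq_add_neg, QuadraticMap.polar_add_left, QuadraticMap.polar_neg_left,
    QuadraticMap.polar_smul_left, hpolar, QuadraticMap.polar_comm _ _ s,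
    QuadraticMap.polar_comm _ _ (σ s), smul_eq_mul]
  have h2 := h'.ne_zero
  field_simp
  linear_combination -h1

end IsRegular

end AlbertForm

end IntertwiningOfSimilarity

/-- Let `k` be a field of characteristic not 2 or 3 and `m ∈ {1,2,4,8}`.
Two `(8,m)`-product algebras over `k` are isotopic iff their Albert forms are similar
(one is isometric to a nonzero scalar multiple of the other). -/
theorem isotopic_iff_albert_forms_similar
    {k : Type u} [Field k] (hk2 : (2 : k) ≠ 0) (hk3 : (3 : k) ≠ 0)
    (m : ℕ) (hm : m ∈ ({1, 2, 4, 8} : Set ℕ))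
    (A A' : AlgebraWithInvolution k)
    (hA : IsProductAlgebra A 8 m) (hA' : IsProductAlgebra A' 8 m)
    (Φ : AlbertForm A) (Φ' : AlbertForm A') :
    A.IsIsotopic A' ↔
      ∃ c : kˣ, Nonempty (QuadraticMap.IsometryEquiv ((c : k) • Φ.Q) Φ'.Q) := by
  obtain ⟨P⟩ := hA
  obtain ⟨P'⟩ := hA'
  have hm0 : (m : k) ≠ 0 := by
    rcases hm with rfl | rfl | rfl | rfl
    · simp
    · simpa using hk2
    · rw [show ((4 : ℕ) : k) = 2 ^ 2 by norm_num]
      exact pow_ne_zero _ hk2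
    · rw [show ((8 : ℕ) : k) = 2 ^ 3 by norm_num]
      exact pow_ne_zero _ hk2
  have h8 : ((8 * m : ℕ) : k) ≠ 0 := by
    rw [Nat.cast_mul, show ((8 : ℕ) : k) = 2 ^ 3 by norm_num]
    exact mul_ne_zero (pow_ne_zero _ hk2) hm0
  have h := P.isRegular hk2 hk3 hm0 Φ
  have h' := P'.isRegular hk2 hk3 hm0 Φ'
  constructor
  · rintro ⟨I⟩
    exact AlbertForm.exists_isometryEquiv_of_isotopy hk2 hk3 h h' I
  · rintro ⟨c, ⟨τ⟩⟩
    exact h.isIsotopic hk2 h' h8 c.ne_zero τ.toLinearEquiv τ.map_app
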